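/- arXiv:2512.05195 — 6 statements merged into one kernel-verified Lean document; each statement's English description precedes it below -/
import Mathlib

section
/- The harmonic quadratic form h = (x_0 − i·x_1)·x_2 ∈ ℂ[x_0,x_1,x_2] has Waring rank rk(h) = 2 and isotropic rank irk(h) = 4. -/
open MvPolynomial

/-- The linear form with coefficient vector `a`. -/
noncomputable def lin {n : ℕ} (a : Fin n → ℂ) : MvPolynomial (Fin n) ℂ :=
  ∑ i, MvPolynomial.C (a i) * MvPolynomial.X i

/-- The Laplace operator `Δ = ∑ ∂²/∂xᵢ²`. -/
noncomputable def lap {n : ℕ} (p : MvPolynomial (Fin n) ℂ) : MvPolynomial (Fin n) ℂ :=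
  ∑ i, MvPolynomial.pderiv i (MvPolynomial.pderiv i p)

/-- A coefficient vector (linear form) is isotropic if `∑ aᵢ² = 0`. -/
def Isotropic {n : ℕ} (a : Fin n → ℂ) : Prop :=
  ∑ i, (a i) ^ 2 = 0

/-- Isotropic rank: least `r` such that `h` is a sum of `r` `d`-th powers of
isotropic linear forms. -/
noncomputable def irk {n : ℕ} (d : ℕ) (h : MvPolynomial (Fin n) ℂ) : ℕ :=
  sInf {r : ℕ | ∃ ℓ : Fin r → (Fin n → ℂ),
    (∀ j, Isotropic (ℓ j)) ∧ h = ∑ j, (lin (ℓ j)) ^ d}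

/-- Waring rank: least `r` such that `h` is a sum of `r` `d`-th powers of
linear forms. -/
noncomputable def wrk {n : ℕ} (d : ℕ) (h : MvPolynomial (Fin n) ℂ) : ℕ :=
  sInf {r : ℕ | ∃ ℓ : Fin r → (Fin n → ℂ), h = ∑ j, (lin (ℓ j)) ^ d}

theorem eval_lin_aux (a x : Fin 3 → ℂ) :
    eval x (lin a) = a 0 * x 0 + a 1 * x 1 + a 2 * x 2 := by
  simp [lin, Fin.sum_univ_three]

/-- No decomposition into three squares of isotropic forms. -/
theorem core_aux (a : Fin 3 → Fin 3 → ℂ) (hi : ∀ j, Isotropic (a j))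
    (h : ((X 0 - C Complex.I * X 1) * X 2 : MvPolynomial (Fin 3) ℂ) = ∑ j, (lin (a j)) ^ 2) :
    False := by
  have hI : Complex.I ^ 2 = -1 := Complex.I_sq
  have key : ∀ x : Fin 3 → ℂ, (x 0 - Complex.I * x 1) * x 2
      = ∑ j, (a j 0 * x 0 + a j 1 * x 1 + a j 2 * x 2) ^ 2 := by
    intro x
    have := congrArg (eval x) h
    simpa [eval_lin_aux] using this
  obtain ⟨u, hu⟩ : ∃ u : Fin 3 → ℂ, ∀ j, u j = a j 0 + Complex.I * a j 1 := ⟨_, fun _ => rfl⟩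
  obtain ⟨v, hv⟩ : ∃ v : Fin 3 → ℂ, ∀ j, v j = a j 0 - Complex.I * a j 1 := ⟨_, fun _ => rfl⟩
  obtain ⟨w, hw⟩ : ∃ w : Fin 3 → ℂ, ∀ j, w j = a j 2 := ⟨_, fun _ => rfl⟩
  have hq : ∀ j, u j * v j = - (w j) ^ 2 := by
    intro j
    have := hi j
    simp only [Isotropic, Fin.sum_univ_three] at this
    rw [hu, hv, hw]
    linear_combination this - a j 1 ^ 2 * hI
  have gen : ∀ p q r : ℂ, 2 * p * r = ∑ j, (p * u j + q * v j + r * w j) ^ 2 := by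
    intro p q r
    have := key ![p + q, Complex.I * (p - q), r]
    simp only [Matrix.cons_val] at this
    have e : (p + q - Complex.I * (Complex.I * (p - q))) * r = 2 * p * r := by
      linear_combination -(p - q) * r * hI
    rw [e] at this
    rw [this]
    refine Finset.sum_congr rfl fun j _ => ?_
    rw [hu, hv, hw]
    ring
  simp only [Fin.sum_univ_three] at gen
  have uu := gen 1 0 0
  have vv := gen 0 1 0
  have ww := gen 0 0 1
  have uv := gen 1 1 0
  have uw := gen 1 0 1
  have vw := gen 0 1 1
  have UW : u 0 * w 0 + u 1 * w 1 + u 2 * w 2 = 1 := by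
    linear_combination (uu + ww - uw) / 2
  have UV : u 0 * v 0 + u 1 * v 1 + u 2 * v 2 = 0 := by
    linear_combination (uu + vv - uv) / 2
  have VW : v 0 * w 0 + v 1 * w 1 + v 2 * w 2 = 0 := by
    linear_combination (vv + ww - vw) / 2
  have UU : u 0 ^ 2 + u 1 ^ 2 + u 2 ^ 2 = 0 := by linear_combination -uu
  have VV : v 0 ^ 2 + v 1 ^ 2 + v 2 ^ 2 = 0 := by linear_combination -vv
  have WW : w 0 ^ 2 + w 1 ^ 2 + w 2 ^ 2 = 0 := by linear_combination -ww
  have hv0 : ∀ j, v j = 0 := by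
    have hdet : (Matrix.of ![u, v, w]).det = 0 := by
      have hG : Matrix.of ![u, v, w] * (Matrix.of ![u, v, w]).transpose
          = !![0, 0, 1; 0, 0, 0; 1, 0, 0] := by
        ext i j
        fin_cases i <;> fin_cases j <;>
          simp [Matrix.mul_apply, Fin.sum_univ_three] <;>
          first
          | linear_combination UU
          | linear_combination VV
          | linear_combination WW
          | linear_combination UV
          | linear_combination UW
          | linear_combination VW
      have h2 := congrArg Matrix.det hG
      rw [Matrix.det_mul, Matrix.det_transpose] at h2
      have h3 : (!![0, 0, 1; 0, 0, 0; 1, 0, 0] : Matrix (Fin 3) (Fin 3) ℂ).det = 0 := by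
        simp [Matrix.det_fin_three]
      rw [h3] at h2
      exact mul_self_eq_zero.mp h2
    obtain ⟨x, hx, hx0⟩ := Matrix.exists_vecMul_eq_zero_iff.mpr hdet
    have hc : ∀ j, x 0 * u j + x 1 * v j + x 2 * w j = 0 := by
      intro j
      have := congrFun hx0 j
      simpa [Matrix.vecMul, dotProduct, Fin.sum_univ_three] using this
    have x2 : x 2 = 0 := by
      linear_combination u 0 * hc 0 + u 1 * hc 1 + u 2 * hc 2 - x 0 * UU - x 1 * UV - x 2 * UW
    have x0 : x 0 = 0 := by
      linear_combination w 0 * hc 0 + w 1 * hc 1 + w 2 * hc 2 - x 0 * UW - x 1 * VW - x 2 * WW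
    have x1 : x 1 ≠ 0 := by
      intro x1
      apply hx
      ext j
      fin_cases j <;> simp [x0, x1, x2]
    intro j
    have := hc j
    simpa [x0, x2, x1] using this
  have hw0 : ∀ j, w j = 0 := by
    intro j
    have := hq j
    simpa [hv0] using this
  simp [hw0] at UW

theorem irk_lower_aux (r : ℕ) (hr : r < 4) (ℓ : Fin r → Fin 3 → ℂ) (hi : ∀ j, Isotropic (ℓ j))
    (h : ((X 0 - C Complex.I * X 1) * X 2 : MvPolynomial (Fin 3) ℂ) = ∑ j, (lin (ℓ j)) ^ 2) :
    False := by
  have hz : Isotropic (0 : Fin 3 → ℂ) := by simp [Isotropic]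
  have lz : lin (0 : Fin 3 → ℂ) = 0 := by simp [lin]
  interval_cases r
  · refine core_aux ![0, 0, 0] ?_ ?_
    · intro j; fin_cases j <;> exact hz
    · rw [h]; simp [Fin.sum_univ_three, lz]
  · refine core_aux ![ℓ 0, 0, 0] ?_ ?_
    · intro j; fin_cases j
      exacts [hi 0, hz, hz]
    · rw [h]; simp [Fin.sum_univ_three, lz]
  · refine core_aux ![ℓ 0, ℓ 1, 0] ?_ ?_
    · intro j; fin_cases j
      exacts [hi 0, hi 1, hz]
    · rw [h]; simp [Fin.sum_univ_three, lz]
  · exact core_aux ℓ hi h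

theorem wrk_lower_aux (r : ℕ) (hr : r < 2) (ℓ : Fin r → Fin 3 → ℂ)
    (h : ((X 0 - C Complex.I * X 1) * X 2 : MvPolynomial (Fin 3) ℂ) = ∑ j, (lin (ℓ j)) ^ 2) :
    False := by
  have h1 := congrArg (eval ![1, 0, 0]) h
  have h3 := congrArg (eval ![1, 0, 1]) h
  have h2 := congrArg (eval ![0, 0, 1]) h
  interval_cases r
  · simp at h3
  · simp [eval_lin_aux] at h1 h2 h3
    have e1 := pow_eq_zero_iff (two_ne_zero) |>.mp h1.symm
    have e2 := pow_eq_zero_iff (two_ne_zero) |>.mp h2.symm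
    simp [e1, e2] at h3

theorem wrk_upper_aux : ∃ ℓ : Fin 2 → (Fin 3 → ℂ),
    ((X 0 - C Complex.I * X 1) * X 2 : MvPolynomial (Fin 3) ℂ) = ∑ j, (lin (ℓ j)) ^ 2 := by
  have hI : Complex.I ^ 2 = -1 := Complex.I_sq
  refine ⟨![![1 / 2, -Complex.I / 2, 1 / 2], ![Complex.I / 2, 1 / 2, -Complex.I / 2]], ?_⟩
  apply MvPolynomial.funext
  intro x
  simp only [Fin.sum_univ_two, map_add, map_pow, eval_lin_aux, map_mul, map_sub, eval_X, eval_C,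
    Matrix.cons_val]
  linear_combination (-(x 0 ^ 2 + x 1 ^ 2 + x 2 ^ 2 - 2 * x 0 * x 2) / 4) * hI

theorem irk_upper_aux : ∃ ℓ : Fin 4 → (Fin 3 → ℂ), (∀ j, Isotropic (ℓ j)) ∧
    ((X 0 - C Complex.I * X 1) * X 2 : MvPolynomial (Fin 3) ℂ) = ∑ j, (lin (ℓ j)) ^ 2 := by
  have hI : Complex.I ^ 2 = -1 := Complex.I_sq
  obtain ⟨z, hz⟩ := IsAlgClosed.exists_pow_nat_eq Complex.I (n := 2) (by norm_num)
  refine ⟨![![0, -Complex.I / 2, 1 / 2], ![0, 1 / 2, -Complex.I / 2],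
    ![Complex.I * z / 2, 0, -z / 2], ![z / 2, 0, -Complex.I * z / 2]], ?_, ?_⟩
  · intro j
    fin_cases j <;> simp [Isotropic, Fin.sum_univ_three, div_pow, mul_pow] <;> ring
  · apply MvPolynomial.funext
    intro x
    simp only [Fin.sum_univ_four, map_add, map_pow, eval_lin_aux, map_mul, map_sub, eval_X, eval_C,
      Matrix.cons_val]
    rw [← sub_eq_zero]
    ring_nf
    simp only [hz, hI]
    ring_nf
    simp only [hI]
    ring_nf

/-- The harmonic quadratic form `(x₀ − i·x₁)·x₂` has Waring rank `2` and
isotropic rank `4`. -/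
theorem stmt10 :
    wrk 2 ((X 0 - C Complex.I * X 1) * X 2 : MvPolynomial (Fin 3) ℂ) = 2 ∧
    irk 2 ((X 0 - C Complex.I * X 1) * X 2 : MvPolynomial (Fin 3) ℂ) = 4 := by
  refine ⟨?_, ?_⟩
  · refine le_antisymm (Nat.sInf_le wrk_upper_aux) ?_
    refine le_csInf ⟨2, wrk_upper_aux⟩ ?_
    rintro r ⟨ℓ, h⟩
    by_contra hr
    exact wrk_lower_aux r (by omega) ℓ h
  · refine le_antisymm (Nat.sInf_le irk_upper_aux) ?_
    refine le_csInf ⟨4, irk_upper_aux⟩ ?_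
    rintro r ⟨ℓ, hi, h⟩
    by_contra hr
    exact irk_lower_aux r (by omega) ℓ hi h
end

section
/- For every integer k ≥ 2, the harmonic quadratic form h_k = (1+i)·∑_{j=0}^{k−1} (x_{3j} − i·x_{3j+2})·x_{3j+1} ∈ ℂ[x_0,…,x_{3k−1}] satisfies irk(h_k) = 2k. (Since each summand (1+i)(x_{3j} − i x_{3j+2})x_{3j+1}, viewed in its own three variables, has isotropic rank 4, this shows in particular that the isotropic rank is not additive for sums of forms in disjoint sets of variables.) -/
open MvPolynomial

theorem lt_zero {k : ℕ} (j : Fin k) : 3 * j.1 < 3 * k := by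
  have := j.isLt
  omega

theorem lt_one {k : ℕ} (j : Fin k) : 3 * j.1 + 1 < 3 * k := by
  have := j.isLt
  omega

theorem lt_two {k : ℕ} (j : Fin k) : 3 * j.1 + 2 < 3 * k := by
  have := j.isLt
  omega

/-- Summation over `Fin (3k)` by blocks of three. -/
theorem sum_blocks {M : Type*} [AddCommMonoid M] (k : ℕ) (f : Fin (3 * k) → M) :
    ∑ i, f i = ∑ j : Fin k, (f ⟨3 * j.1, lt_zero j⟩ +
      f ⟨3 * j.1 + 1, lt_one j⟩ + f ⟨3 * j.1 + 2, lt_two j⟩) := by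
  have e : ∑ i, f i = ∑ p : Fin k × Fin 3,
      f ⟨3 * p.1.1 + p.2.1, by have := p.1.isLt; have := p.2.isLt; omega⟩ := by
    symm
    refine Fintype.sum_bijective
      (fun p : Fin k × Fin 3 => (⟨3 * p.1.1 + p.2.1, by
        have := p.1.isLt; have := p.2.isLt; omega⟩ : Fin (3 * k))) ⟨?_, ?_⟩ _ _ (fun _ => rfl)
    · rintro ⟨⟨a, ha⟩, ⟨b, hb⟩⟩ ⟨⟨c, hc⟩, ⟨d, hd⟩⟩ h
      simp only [Fin.mk.injEq] at h
      simp only [Prod.mk.injEq, Fin.mk.injEq]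
      omega
    · rintro ⟨i, hi⟩
      refine ⟨(⟨i / 3, by omega⟩, ⟨i % 3, by omega⟩), ?_⟩
      simp only [Fin.mk.injEq]
      omega
  rw [e, Fintype.sum_prod_type]
  simp [Fin.sum_univ_three]

/-- The vector `∑ aⱼ uⱼ + bⱼ vⱼ`. -/
noncomputable def wvec {k : ℕ} (a b : Fin k → ℂ) : Fin (3 * k) → ℂ := fun i =>
  if i.1 % 3 = 0 then a ⟨i.1 / 3, by have := i.isLt; omega⟩
  else if i.1 % 3 = 1 then b ⟨i.1 / 3, by have := i.isLt; omega⟩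
  else -Complex.I * a ⟨i.1 / 3, by have := i.isLt; omega⟩

theorem wvec0 {k : ℕ} (a b : Fin k → ℂ) (j : Fin k) (h : 3 * j.1 < 3 * k) :
    wvec a b ⟨3 * j.1, h⟩ = a j := by
  simp [wvec]

theorem wvec1 {k : ℕ} (a b : Fin k → ℂ) (j : Fin k) (h : 3 * j.1 + 1 < 3 * k) :
    wvec a b ⟨3 * j.1 + 1, h⟩ = b j := by
  have h1 : (3 * j.1 + 1) % 3 = 1 := by omega
  have h2 : (3 * j.1 + 1) / 3 = j.1 := by omega
  simp [wvec, h1, h2]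

theorem wvec2 {k : ℕ} (a b : Fin k → ℂ) (j : Fin k) (h : 3 * j.1 + 2 < 3 * k) :
    wvec a b ⟨3 * j.1 + 2, h⟩ = -Complex.I * a j := by
  have h1 : (3 * j.1 + 2) % 3 = 2 := by omega
  have h2 : (3 * j.1 + 2) / 3 = j.1 := by omega
  simp [wvec, h1, h2]

theorem wvec_iso {k : ℕ} (a b : Fin k → ℂ) (hb : ∑ j, b j ^ 2 = 0) : Isotropic (wvec a b) := by
  unfold Isotropic
  rw [sum_blocks, ← hb]
  refine Finset.sum_congr rfl fun j _ => ?_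
  rw [wvec0, wvec1, wvec2]
  linear_combination (a j) ^ 2 * Complex.I_sq

/-- `uⱼ`. -/
noncomputable def uu (k : ℕ) (j : Fin k) : MvPolynomial (Fin (3 * k)) ℂ :=
  X (⟨3 * j.1, lt_zero j⟩ : Fin (3 * k)) -
            C Complex.I * X ⟨3 * j.1 + 2, lt_two j⟩
/-- `vⱼ`. -/
noncomputable def vv (k : ℕ) (j : Fin k) : MvPolynomial (Fin (3 * k)) ℂ :=
  X ⟨3 * j.1 + 1, lt_one j⟩

theorem lin_wvec {k : ℕ} (a b : Fin k → ℂ) :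
    lin (wvec a b) = ∑ j, C (a j) * uu k j + ∑ j, C (b j) * vv k j := by
  unfold lin
  rw [sum_blocks, ← Finset.sum_add_distrib]
  refine Finset.sum_congr rfl fun j _ => ?_
  rw [wvec0, wvec1, wvec2]
  simp only [uu, vv, C_mul, C_neg]
  ring

theorem CI_sq {σ : Type*} : (C Complex.I : MvPolynomial σ ℂ) ^ 2 = -1 := by
  rw [← C_pow, Complex.I_sq]; simp

theorem upper_of (k : ℕ) (c : ℂ) (A B : Fin k → Fin k → ℂ)
    (hB : ∀ m, ∑ j, B m j ^ 2 = 0)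
    (h : ∑ m, 4 * ((∑ j, C (A m j) * uu k j) * ∑ j, C (B m j) * vv k j)
      = C c * ∑ j, uu k j * vv k j) :
    ∃ ℓ : Fin (2 * k) → (Fin (3 * k) → ℂ), (∀ j, Isotropic (ℓ j)) ∧
      C c * ∑ j, uu k j * vv k j = ∑ j, (lin (ℓ j)) ^ 2 := by
  let g : Fin k ⊕ Fin k → (Fin (3 * k) → ℂ) :=
    Sum.elim (fun m => wvec (A m) (B m))
      (fun m => wvec (fun j => -Complex.I * A m j) (fun j => Complex.I * B m j))
  let e : Fin (2 * k) ≃ Fin k ⊕ Fin k := (finCongr (two_mul k)).trans finSumFinEquiv.symm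
  have hg : ∀ x, Isotropic (g x) := by
    rintro (m | m)
    · exact wvec_iso (A m) (B m) (hB m)
    · have hm : ∑ j, (Complex.I * B m j) ^ 2 = 0 := by
        simp only [mul_pow, ← Finset.mul_sum, hB m, mul_zero]
      exact wvec_iso (fun j => -Complex.I * A m j) (fun j => Complex.I * B m j) hm
  refine ⟨fun j => g (e j), fun j => hg _, ?_⟩
  have h1 : ∑ j, lin (g (e j)) ^ 2 = ∑ x, lin (g x) ^ 2 :=
    Equiv.sum_comp e (fun x => lin (g x) ^ 2)
  have h2 : ∑ x, lin (g x) ^ 2 = ∑ m, (lin (g (Sum.inl m)) ^ 2 + lin (g (Sum.inr m)) ^ 2) := by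
    rw [Fintype.sum_sum_type, Finset.sum_add_distrib]
  rw [h1, h2, ← h]
  refine Finset.sum_congr rfl fun m _ => ?_
  simp only [g, Sum.elim_inl, Sum.elim_inr, lin_wvec, C_mul, C_neg, mul_assoc, neg_mul,
    ← Finset.mul_sum, Finset.sum_neg_distrib]
  generalize (∑ j, C (A m j) * uu k j) = a
  generalize (∑ j, C (B m j) * vv k j) = b
  linear_combination (-(b - a) ^ 2) * CI_sq (σ := Fin (3 * k))

theorem upper (n : ℕ) (c : ℂ) :
    ∃ ℓ : Fin (2 * (n + 2)) → (Fin (3 * (n + 2)) → ℂ), (∀ j, Isotropic (ℓ j)) ∧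
      C c * ∑ j, uu (n + 2) j * vv (n + 2) j = ∑ j, (lin (ℓ j)) ^ 2 := by
  let I := Complex.I
  let B : Fin (n + 2) → Fin (n + 2) → ℂ :=
    Fin.cons (Fin.cons 1 (Fin.cons I fun _ => 0))
      (Fin.cons (Fin.cons I (Fin.cons 1 fun _ => 0))
        (fun m => Fin.cons I (Fin.cons 0 (Pi.single m 1))))
  let A : Fin (n + 2) → Fin (n + 2) → ℂ :=
    Fin.cons (Fin.cons (c / 8) (Fin.cons (-I * (c / 8)) fun _ => -I * (c / 8)))
      (Fin.cons (Fin.cons (-I * (c / 8)) (Fin.cons (c / 8) fun _ => - (c / 8)))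
        (fun m => Fin.cons 0 (Fin.cons 0 (Pi.single m (c / 4)))))
  refine upper_of (n + 2) c A B ?_ ?_
  · intro m
    refine Fin.cases ?_ (fun m => Fin.cases ?_ (fun m => ?_) m) m
    · simp [B, I, Fin.sum_univ_succ]
    · simp [B, I, Fin.sum_univ_succ]
    · simp [B, I, Fin.sum_univ_succ, Pi.single_apply]
  · have h8 : (C c : MvPolynomial (Fin (3 * (n + 2))) ℂ) = 8 * C (c / 8) := by
      rw [show (8 : MvPolynomial (Fin (3 * (n + 2))) ℂ) = C 8 from (map_ofNat C 8).symm, ← C_mul]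
      congr 1; ring
    have h4 : (C (c / 4) : MvPolynomial (Fin (3 * (n + 2))) ℂ) = 2 * C (c / 8) := by
      rw [show (2 : MvPolynomial (Fin (3 * (n + 2))) ℂ) = C 2 from (map_ofNat C 2).symm, ← C_mul]
      congr 1; ring
    have hs : ∀ (x : ℂ) (m : Fin n) (f : Fin n → MvPolynomial (Fin (3 * (n + 2))) ℂ),
        ∑ j, C ((Pi.single m x : Fin n → ℂ) j) * f j = C x * f m := by
      intro x m f
      rw [Finset.sum_eq_single m]
      · simp
      · intro b _ hb; simp [hb]
      · simp
    simp only [Fin.sum_univ_succ, A, B, Fin.cons_zero, Fin.cons_succ, hs, C_0, zero_mul,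
      Finset.sum_const_zero, add_zero, zero_add, ← Finset.mul_sum, C_mul, C_neg, C_1, one_mul, h4, h8]
    have e : ∀ m : Fin n, (2 * C (c / 8) * uu (n + 2) m.succ.succ *
        (C I * vv (n + 2) 0 + vv (n + 2) m.succ.succ)) =
        2 * C (c / 8) * C I * vv (n + 2) 0 * uu (n + 2) m.succ.succ
          + 2 * C (c / 8) * (uu (n + 2) m.succ.succ * vv (n + 2) m.succ.succ) := by
      intro m; ring
    simp only [e, Finset.sum_add_distrib, ← Finset.mul_sum]
    generalize (∑ i : Fin n, uu (n + 2) i.succ.succ) = S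
    generalize (∑ i : Fin n, uu (n + 2) i.succ.succ * vv (n + 2) i.succ.succ) = T
    have hI : (C I : MvPolynomial (Fin (3 * (n + 2))) ℂ) ^ 2 = -1 := CI_sq
    generalize (C I : MvPolynomial (Fin (3 * (n + 2))) ℂ) = i at *
    generalize uu (n + 2) 0 = u0
    generalize vv (n + 2) 0 = v0
    generalize uu (n + 2) (Fin.succ 0) = u1
    generalize vv (n + 2) (Fin.succ 0) = v1
    generalize (C (c / 8) : MvPolynomial (Fin (3 * (n + 2))) ℂ) = d
    linear_combination (-4 * d * (u0 * v0 + u1 * v1 + S * v1)) * hI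

theorem lower (k : ℕ) (c : ℂ) (hc : c ≠ 0) (r : ℕ) (ℓ : Fin r → (Fin (3 * k) → ℂ))
    (h : C c * ∑ j, uu k j * vv k j = ∑ j, (lin (ℓ j)) ^ 2) : 2 * k ≤ r := by
  by_contra hr
  push Not at hr
  let E : ((Fin k → ℂ) × (Fin k → ℂ)) → Fin (3 * k) → ℂ := fun p i =>
    if i.1 % 3 = 0 then p.1 ⟨i.1 / 3, by have := i.isLt; omega⟩
    else if i.1 % 3 = 1 then p.2 ⟨i.1 / 3, by have := i.isLt; omega⟩
    else 0
  have hE : ∀ p q, E (p + q) = E p + E q := by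
    intro p q; ext i; simp only [E, Pi.add_apply, Prod.fst_add, Prod.snd_add]; split_ifs <;> simp
  have hE' : ∀ (a : ℂ) p, E (a • p) = a • E p := by
    intro p q; ext i; simp only [E, Pi.smul_apply, Prod.smul_fst, Prod.smul_snd]; split_ifs <;> simp
  let L : ((Fin k → ℂ) × (Fin k → ℂ)) →ₗ[ℂ] (Fin r → ℂ) :=
    { toFun := fun p m => ∑ i, ℓ m i * E p i
      map_add' := by
        intro p q; ext m; simp [hE, mul_add, Finset.sum_add_distrib]
      map_smul' := by
        intro a q; ext m
        simp only [hE', Pi.smul_apply, smul_eq_mul, Finset.mul_sum, RingHom.id_apply]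
        exact Finset.sum_congr rfl fun _ _ => by ring }
  have key : ∀ p, c * ∑ j, p.1 j * p.2 j = ∑ m, (L p m) ^ 2 := by
    intro p
    have := congrArg (MvPolynomial.eval (E p)) h
    have a1 : ∀ j : Fin k, (3 * j.1 + 1) % 3 = 1 := fun j => by omega
    have a2 : ∀ j : Fin k, (3 * j.1 + 1) / 3 = j.1 := fun j => by omega
    have a3 : ∀ j : Fin k, (3 * j.1 + 2) % 3 = 2 := fun j => by omega
    simpa [uu, vv, lin, E, L, a1, a2, a3] using this
  have hker : ∃ p, p ≠ 0 ∧ L p = 0 := by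
    have : LinearMap.ker L ≠ ⊥ := by
      apply LinearMap.ker_ne_bot_of_finrank_lt
      simp; omega
    obtain ⟨p, hp, hp0⟩ := (Submodule.ne_bot_iff _).1 this
    exact ⟨p, hp0, hp⟩
  obtain ⟨p, hp0, hp⟩ := hker
  have inv : ∀ q, ∑ j, (p + q).1 j * (p + q).2 j = ∑ j, q.1 j * q.2 j := by
    intro q
    apply mul_left_cancel₀ hc
    rw [key, key, map_add, hp, zero_add]
  have i0 : ∑ j, p.1 j * p.2 j = 0 := by simpa using inv 0
  apply hp0
  ext j
  · have := inv (0, Pi.single j 1)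
    simpa [mul_add, Finset.sum_add_distrib, i0, Pi.single_apply] using this
  · have := inv (Pi.single j 1, 0)
    simpa [add_mul, Finset.sum_add_distrib, i0, Pi.single_apply] using this

/-- The harmonic quadratic form
`(1+i)·∑_{j=0}^{k−1} (x_{3j} − i·x_{3j+2})·x_{3j+1}` has isotropic rank `2k`
for every `k ≥ 2`. -/
theorem stmt11 (k : ℕ) (hk : 2 ≤ k) :
    irk 2 ((C (1 + Complex.I) *
      ∑ j : Fin k,
        (X (⟨3 * j.1, by have := j.isLt; omega⟩ : Fin (3 * k)) -
            C Complex.I * X ⟨3 * j.1 + 2, by have := j.isLt; omega⟩) *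
          X ⟨3 * j.1 + 1, by have := j.isLt; omega⟩ :
        MvPolynomial (Fin (3 * k)) ℂ)) = 2 * k := by
  have hc : (1 + Complex.I) ≠ 0 := by
    intro h
    have := congrArg Complex.re h
    simp at this
  obtain ⟨n, rfl⟩ : ∃ n, k = n + 2 := ⟨k - 2, by omega⟩
  have hu := upper n (1 + Complex.I)
  apply le_antisymm
  · exact Nat.sInf_le hu
  · refine le_csInf ⟨_, hu⟩ ?_
    rintro r ⟨ℓ, -, h⟩
    exact lower (n + 2) _ hc r ℓ h
end

section
/- Let n ≥ 0, r ≥ 0, let ℓ_0,…,ℓ_r be linearly independent linear forms in ℂ[x_0,…,x_n], and let a_0,…,a_r ≥ 1 be integers. Then the product m = ℓ_0^{a_0}·…·ℓ_r^{a_r} is harmonic if and only if ℓ_i and ℓ_j are orthogonal for all 0 ≤ i < j ≤ r and ℓ_k is isotropic for every index k with a_k > 1. -/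
open MvPolynomial

noncomputable def phiHom {n r : ℕ} (ℓ : Fin r → (Fin n → ℂ)) :
    MvPolynomial (Fin r) ℂ →ₐ[ℂ] MvPolynomial (Fin n) ℂ := aeval (fun i => lin (ℓ i))

lemma pderiv_lin {n : ℕ} (v : Fin n → ℂ) (t : Fin n) : pderiv t (lin v) = C (v t) := by
  classical
  simp only [lin, map_sum, pderiv_C_mul, pderiv_X, Pi.single_apply]
  rw [Finset.sum_eq_single t]
  · simp [smul_eq_C_mul]
  · intro b _ hb; simp [hb.symm, hb]
  · simp

lemma pderiv_phi {n r : ℕ} (ℓ : Fin r → (Fin n → ℂ)) (t : Fin n) (Q : MvPolynomial (Fin r) ℂ) :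
    pderiv t (phiHom ℓ Q) = phiHom ℓ (∑ i, C (ℓ i t) * pderiv i Q) := by
  classical
  induction Q using MvPolynomial.induction_on with
  | C c => simp [phiHom, algebraMap_eq]
  | add p q hp hq => simp only [map_add, hp, hq, mul_add, Finset.sum_add_distrib]
  | mul_X p i hp =>
    have hX : phiHom ℓ (X i) = lin (ℓ i) := by simp [phiHom]
    have hC : ∀ c, phiHom ℓ (C c) = C c := by intro c; simp [phiHom, algebraMap_eq]
    have h1 : ∑ j, C (ℓ j t) * pderiv j (p * X i)
        = (∑ j, C (ℓ j t) * pderiv j p) * X i + p * C (ℓ i t) := by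
      simp only [pderiv_mul, mul_add, Finset.sum_add_distrib, Finset.sum_mul, mul_assoc]
      congr 1
      rw [Finset.sum_eq_single i]
      · simp; ring
      · intro b _ hb; simp [pderiv_X, Pi.single_apply, hb.symm, hb]
      · simp
    rw [h1, map_mul, pderiv_mul, hp, hX, pderiv_lin]
    simp only [map_add, map_mul, hX, hC]

lemma phi_inj {n r : ℕ} (ℓ : Fin r → (Fin n → ℂ)) (hli : LinearIndependent ℂ ℓ) :
    Function.Injective (phiHom ℓ) := by
  classical
  obtain ⟨g, hg⟩ := LinearMap.exists_leftInverse_of_injective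
    (Fintype.linearCombination ℂ ℓ) (LinearMap.ker_eq_bot.2 hli.fintypeLinearCombination_injective)
  have hg' : ∀ i, g (ℓ i) = Pi.single i 1 := by
    intro i
    have := LinearMap.congr_fun hg (Pi.single i 1)
    simpa [Fintype.linearCombination_apply_single] using this
  let ψ : MvPolynomial (Fin n) ℂ →ₐ[ℂ] MvPolynomial (Fin r) ℂ :=
    aeval (fun t => lin (g (Pi.single t 1)))
  have hψ : ∀ v, ψ (lin v) = lin (g v) := by
    intro v
    have hv : g v = ∑ t, v t • g (Pi.single t 1) := by
      conv_lhs => rw [pi_eq_sum_univ' v]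
      simp [map_sum]
    rw [hv]
    simp only [ψ, lin, map_sum, map_mul, aeval_X, aeval_C, algebraMap_eq, Finset.sum_apply,
      Pi.smul_apply, smul_eq_mul, Finset.sum_mul, Finset.mul_sum]
    rw [Finset.sum_comm]
    simp [mul_assoc]
  have hcomp : ψ.comp (phiHom ℓ) = AlgHom.id ℂ _ := by
    ext1 i
    have : phiHom ℓ (X i) = lin (ℓ i) := by simp [phiHom]
    simp only [AlgHom.comp_apply, this, hψ, hg', AlgHom.id_apply]
    simp only [lin]
    rw [Finset.sum_eq_single i]
    · simp
    · intro b _ hb; simp [hb]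
    · simp
  exact Function.LeftInverse.injective (g := ψ) (fun x => AlgHom.congr_fun hcomp x)

lemma lap_phi {n r : ℕ} (ℓ : Fin r → (Fin n → ℂ)) (Q : MvPolynomial (Fin r) ℂ) :
    lap (phiHom ℓ Q) =
      phiHom ℓ (∑ i, ∑ j, C (∑ t, ℓ i t * ℓ j t) * pderiv i (pderiv j Q)) := by
  simp only [lap, pderiv_phi, ← map_sum]
  congr 1
  simp only [map_sum, pderiv_C_mul, smul_eq_C_mul, Finset.mul_sum, Finset.sum_mul, map_mul]
  rw [Finset.sum_comm]
  refine Finset.sum_congr rfl fun i _ => ?_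
  rw [Finset.sum_comm]
  simp [mul_assoc]

/-- The coefficient of the iterated derivative. -/
noncomputable def cc {r : ℕ} (s : Fin r →₀ ℕ) (i j : Fin r) : ℕ := s j * (s - Finsupp.single j 1 : Fin r →₀ ℕ) i

lemma key {r : ℕ} (s : Fin r →₀ ℕ) (B : Fin r → Fin r → ℂ) (hB : ∀ i j, B i j = B j i) :
    (∑ i, ∑ j, C (B i j) * pderiv i (pderiv j (monomial s (1 : ℂ)))) = 0 ↔
      ∀ i j, cc s i j ≠ 0 → B i j = 0 := by
  classical
  have hterm : ∀ i j, C (B i j) * pderiv i (pderiv j (monomial s (1 : ℂ))) =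
      monomial (s - Finsupp.single j 1 - Finsupp.single i 1) (B i j * (cc s i j : ℂ)) := by
    intro i j
    simp only [pderiv_monomial, C_mul_monomial, cc]
    push_cast
    congr 1
    simp [mul_assoc]
  simp only [hterm]
  have hs : ∀ i j, cc s i j ≠ 0 →
      s = s - Finsupp.single j 1 - Finsupp.single i 1
        + (Finsupp.single i 1 + Finsupp.single j 1) := by
    intro i j h
    simp only [cc, ne_eq, mul_eq_zero, not_or] at h
    have h1 : Finsupp.single j 1 ≤ s := by
      rw [Finsupp.single_le_iff]; omega
    have h2 : Finsupp.single i 1 ≤ s - Finsupp.single j 1 := by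
      rw [Finsupp.single_le_iff]; omega
    rw [← add_assoc, tsub_add_cancel_of_le h2, tsub_add_cancel_of_le h1]
  constructor
  · intro h i j hij
    have h' := congrArg (coeff (s - Finsupp.single j 1 - Finsupp.single i 1)) h
    simp only [coeff_sum, coeff_monomial, coeff_zero] at h'
    have hN : ∀ p q, (if s - Finsupp.single q 1 - Finsupp.single p 1 =
        s - Finsupp.single j 1 - Finsupp.single i 1 then B p q * (cc s p q : ℂ) else 0)
        = B i j * ((if s - Finsupp.single q 1 - Finsupp.single p 1 =
        s - Finsupp.single j 1 - Finsupp.single i 1 then cc s p q else 0 : ℕ) : ℂ) := by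
      intro p q
      split_ifs with he
      · by_cases hc : cc s p q = 0
        · simp [hc]
        · have e1 := hs p q hc
          have e2 := hs i j hij
          rw [he] at e1
          have e3 := add_left_cancel (e1.symm.trans e2)
          have : (p = i ∧ q = j) ∨ (p = j ∧ q = i) := by
            have := (Finsupp.single_add_single_eq_single_add_single
              (one_ne_zero) (one_ne_zero)).1 e3
            simp at this
            tauto
          rcases this with ⟨rfl, rfl⟩ | ⟨rfl, rfl⟩
          · rfl
          · rw [hB]
      · simp
    simp only [hN, ← Finset.mul_sum, ← Nat.cast_sum] at h'
    rcases mul_eq_zero.1 h' with h' | h'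
    · exact h'
    · exfalso
      rw [Nat.cast_eq_zero] at h'
      have := Finset.sum_eq_zero_iff.1 h' i (Finset.mem_univ _)
      have := Finset.sum_eq_zero_iff.1 this j (Finset.mem_univ _)
      simp at this
      exact hij this
  · intro h
    refine Finset.sum_eq_zero fun i _ => Finset.sum_eq_zero fun j _ => ?_
    by_cases hc : cc s i j = 0
    · simp [hc]
    · simp [h i j hc]

/-- A product of powers of linearly independent linear forms is harmonic iff
the forms are pairwise orthogonal and every form appearing with exponent
greater than one is isotropic. -/
theorem stmt12 (n r : ℕ) (ℓ : Fin (r + 1) → (Fin (n + 1) → ℂ))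
    (a : Fin (r + 1) → ℕ) (hli : LinearIndependent ℂ ℓ) (ha : ∀ i, 1 ≤ a i) :
    lap (∏ i, (lin (ℓ i)) ^ (a i)) = 0 ↔
      ((∀ i j : Fin (r + 1), i < j → ∑ t, ℓ i t * ℓ j t = 0) ∧
       (∀ k, 1 < a k → Isotropic (ℓ k))) := by
  classical
  set s : Fin (r + 1) →₀ ℕ := Finsupp.equivFunOnFinite.symm a with hsdef
  have hsa : ∀ i, s i = a i := fun i => rfl
  have hP : ∏ i, (lin (ℓ i)) ^ (a i) = phiHom ℓ (monomial s 1) := by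
    rw [phiHom, aeval_monomial, Finsupp.prod_fintype _ _ (fun i => pow_zero _)]
    simp [hsa]
  rw [hP, lap_phi, map_eq_zero_iff _ (phi_inj ℓ hli),
    key s (fun i j => ∑ t, ℓ i t * ℓ j t) (fun i j => by simp [mul_comm])]
  have hne : ∀ i j, i ≠ j → cc s i j ≠ 0 := by
    intro i j hij
    have h1 := ha i
    have h2 := ha j
    simp [cc, hsa, Finsupp.single_apply, hij.symm]
    omega
  have heq : ∀ i, cc s i i ≠ 0 ↔ 1 < a i := by
    intro i
    have h1 := ha i
    simp [cc, hsa]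
    omega
  constructor
  · intro h
    refine ⟨fun i j hij => h i j (hne i j hij.ne), fun k hk => ?_⟩
    have := h k k ((heq k).2 hk)
    simpa [Isotropic, sq] using this
  · rintro ⟨h1, h2⟩ i j hc
    rcases lt_trichotomy i j with h | rfl | h
    · exact h1 i j h
    · have := h2 i ((heq i).1 hc)
      simpa [Isotropic, sq] using this
    · have := h1 j i h
      simpa [mul_comm] using this
end

section
/- Let n ≥ 1, r ≥ 0, let ℓ_0,…,ℓ_r be linearly independent, pairwise orthogonal linear forms in ℂ[x_0,…,x_n], and let 1 ≤ a_0 ≤ a_1 ≤ … ≤ a_r be integers such that ℓ_k is isotropic for every index k with a_k > 1 (so that the monomial m = ℓ_0^{a_0}·…·ℓ_r^{a_r} is harmonic). If the number of indices i ∈ {0,…,r} for which ℓ_i is NOT isotropic is different from 1, then irk(m) = ∏_{i=1}^r (a_i + 1), where an empty product equals 1. -/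
open MvPolynomial

lemma lin_add' {n : ℕ} (u v : Fin n → ℂ) : lin (u + v) = lin u + lin v := by
  simp [lin, add_mul, Finset.sum_add_distrib]

lemma lin_smul' {n : ℕ} (c : ℂ) (u : Fin n → ℂ) : lin (c • u) = C c * lin u := by
  simp [lin, Finset.mul_sum, mul_assoc]

/-- `lin` as a linear map. -/
noncomputable def linL (n : ℕ) : (Fin n → ℂ) →ₗ[ℂ] MvPolynomial (Fin n) ℂ where
  toFun := lin
  map_add' := lin_add'
  map_smul' c u := by rw [lin_smul', RingHom.id_apply, MvPolynomial.smul_eq_C_mul]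

lemma lin_single {n : ℕ} (i : Fin n) : lin (Pi.single i (1 : ℂ)) = X i := by
  classical
  unfold lin
  rw [Finset.sum_eq_single i]
  · simp
  · intro j _ hj; simp [hj]
  · simp

lemma lin_sum {n : ℕ} {ι : Type*} [Fintype ι] (c : ι → ℂ) (v : ι → Fin n → ℂ) :
    lin (∑ i, c i • v i) = ∑ i, C (c i) * lin (v i) := by
  have := map_sum (linL n) (fun i => c i • v i) Finset.univ
  simp only [linL, LinearMap.coe_mk, AddHom.coe_mk] at this
  rw [this]
  simp [lin_smul']

/-- power moments from a power sum decomposition of a monomial -/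
lemma moments {m s : ℕ} (a : Fin m → ℕ) (b : Fin s → Fin m → ℂ)
    (h : ∏ i, (X i : MvPolynomial (Fin m) ℂ) ^ a i = ∑ j, lin (b j) ^ (∑ i, a i))
    (k : Fin m → ℕ) (hk : ∑ i, k i = ∑ i, a i) :
    (Nat.multinomial Finset.univ k : ℂ) * ∑ j, ∏ i, b j i ^ k i = if k = a then 1 else 0 := by
  classical
  have mon : ∀ k : Fin m → ℕ, (∏ i, (X i : MvPolynomial (Fin m) ℂ) ^ k i)
      = monomial (Finsupp.equivFunOnFinite.symm k) 1 := by
    intro k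
    rw [MvPolynomial.monomial_eq]
    simp [Finsupp.prod_fintype]
  have h2 := congrArg (coeff (Finsupp.equivFunOnFinite.symm k)) h
  rw [mon, coeff_monomial, coeff_sum] at h2
  have h3 : ∀ j, coeff (Finsupp.equivFunOnFinite.symm k) (lin (b j) ^ (∑ i, a i))
      = (Nat.multinomial Finset.univ k : ℂ) * ∏ i, b j i ^ k i := by
    intro j
    unfold lin
    rw [Finset.sum_pow_eq_sum_piAntidiag, coeff_sum, Finset.sum_eq_single k]
    · simp only [mul_pow, Finset.prod_mul_distrib]
      rw [mon, ← Finset.prod_congr rfl (fun i _ => C_pow (b j i) (k i)), ← map_prod,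
        ← map_natCast (C : ℂ →+* MvPolynomial (Fin m) ℂ), coeff_C_mul, coeff_C_mul, coeff_monomial]
      simp
    · intro l _ hl
      simp only [mul_pow, Finset.prod_mul_distrib]
      rw [mon, ← Finset.prod_congr rfl (fun i _ => C_pow (b j i) (l i)), ← map_prod,
        ← map_natCast (C : ℂ →+* MvPolynomial (Fin m) ℂ), coeff_C_mul, coeff_C_mul, coeff_monomial]
      rw [if_neg]
      · simp
      · exact fun e => hl (Finsupp.equivFunOnFinite.symm.injective e)
    · intro hk'
      exact absurd (by simp [hk]) hk'
  simp only [h3] at h2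
  rw [← Finset.mul_sum] at h2
  rw [← h2]
  simp [eq_comm]

lemma lower_s13 {r s : ℕ} (a : Fin (r + 1) → ℕ) (ha : 1 ≤ a 0) (b : Fin s → Fin (r + 1) → ℂ)
    (h : ∏ i, (X i : MvPolynomial (Fin (r + 1)) ℂ) ^ a i = ∑ j, lin (b j) ^ (∑ i, a i)) :
    ∏ i : Fin r, (a i.succ + 1) ≤ s := by
  classical
  let W : ((i : Fin r) → Fin (a i.succ + 1)) → Fin s → ℂ := fun β j =>
    if b j 0 = 0 then 0 else ∏ i, (b j i.succ / b j 0) ^ (β i : ℕ)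
  have hW : LinearIndependent ℂ W := by
    rw [Fintype.linearIndependent_iff]
    intro c hc
    by_contra hne
    push Not at hne
    obtain ⟨β, hβ, hmax⟩ := Finset.exists_max_image (Finset.univ.filter fun β => c β ≠ 0)
      (fun β => ∑ i, (β i : ℕ)) (by obtain ⟨i, hi⟩ := hne; exact ⟨i, by simpa using hi⟩)
    simp only [Finset.mem_filter, Finset.mem_univ, true_and] at hβ hmax
    -- the exponent
    let K : ((i : Fin r) → Fin (a i.succ + 1)) → Fin (r + 1) → ℕ := fun γ =>
      Fin.cons (a 0 + ∑ i, (β i : ℕ) - ∑ i, (γ i : ℕ))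
        (fun i => (γ i : ℕ) + (a i.succ - (β i : ℕ)))
    have hle : ∀ i, (β i : ℕ) ≤ a i.succ := fun i => Nat.lt_succ_iff.mp (β i).2
    have hsub : ∑ i, (a i.succ - (β i : ℕ)) + ∑ i, (β i : ℕ) = ∑ i : Fin r, a i.succ := by
      rw [← Finset.sum_add_distrib]
      exact Finset.sum_congr rfl fun i _ => Nat.sub_add_cancel (hle i)
    have hK : ∀ γ, c γ ≠ 0 → ∑ i, K γ i = ∑ i, a i := by
      intro γ hγ
      have := hmax γ hγ
      rw [Fin.sum_univ_succ, Fin.sum_univ_succ]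
      simp only [K, Fin.cons_zero, Fin.cons_succ, Finset.sum_add_distrib]
      omega
    have hKβ : K β = a := by
      funext i
      refine Fin.cases ?_ (fun i => ?_) i
      · simp [K]
      · simp only [K, Fin.cons_succ]; have := hle i; omega
    have hKinj : ∀ γ, K γ = a → γ = β := by
      intro γ hγ
      funext i
      have := congrFun hγ i.succ
      simp only [K, Fin.cons_succ] at this
      have := hle i
      ext; omega
    have hmom := moments a b h
    have hz : ∀ γ, c γ ≠ 0 → γ ≠ β → ∑ j, ∏ i, b j i ^ K γ i = 0 := by
      intro γ hγ hne
      have := hmom (K γ) (hK γ hγ)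
      rw [if_neg (fun e => hne (hKinj γ e))] at this
      rcases mul_eq_zero.mp this with h0 | h0
      · exact absurd (Nat.cast_eq_zero.mp h0) (Nat.multinomial_pos _ _).ne'
      · exact h0
    have hnz : ∑ j, ∏ i, b j i ^ K β i ≠ 0 := by
      intro h0
      have := hmom (K β) (hK β hβ)
      rw [h0, if_pos hKβ] at this
      simp at this
    -- total sum
    have htot : ∑ γ, c γ * ∑ j, ∏ i, b j i ^ K γ i = c β * ∑ j, ∏ i, b j i ^ K β i := by
      apply Finset.sum_eq_single
      · intro γ _ hne
        by_cases hγ : c γ = 0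
        · simp [hγ]
        · rw [hz γ hγ hne, mul_zero]
      · simp
    have hzero : ∑ γ, c γ * ∑ j, ∏ i, b j i ^ K γ i = 0 := by
      simp only [Finset.mul_sum]
      rw [Finset.sum_comm]
      apply Finset.sum_eq_zero
      intro j _
      by_cases hb : b j 0 = 0
      · apply Finset.sum_eq_zero
        intro γ _
        by_cases hγ : c γ = 0
        · simp [hγ]
        · have := hmax γ hγ
          rw [Fin.prod_univ_succ]
          simp only [K, Fin.cons_zero, hb]
          rw [zero_pow (by omega)]; simp
      · have hj := congrFun hc j
        simp only [Finset.sum_apply, Pi.smul_apply, smul_eq_mul, W, hb, if_false,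
          Pi.zero_apply] at hj
        have : ∀ γ, c γ * ∏ i, b j i ^ K γ i =
            (b j 0 ^ (a 0 + ∑ i, (β i : ℕ)) * ∏ i : Fin r, b j i.succ ^ (a i.succ - (β i : ℕ))) *
              (c γ * ∏ i, (b j i.succ / b j 0) ^ (γ i : ℕ)) := by
          intro γ
          by_cases hγ : c γ = 0
          · simp [hγ]
          have hm := hmax γ hγ
          rw [Fin.prod_univ_succ]
          simp only [K, Fin.cons_zero, Fin.cons_succ, pow_add, div_pow, Finset.prod_mul_distrib,
            Finset.prod_div_distrib, Finset.prod_pow_eq_pow_sum]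
          rw [pow_sub₀ _ hb (by omega), pow_add]
          field_simp
        rw [Finset.sum_congr rfl (fun γ _ => this γ), ← Finset.mul_sum, hj, mul_zero]
    rw [hzero] at htot
    exact mul_ne_zero hβ hnz htot.symm
  have := hW.fintype_card_le_finrank
  simpa [Fintype.card_pi] using this

lemma reduce {n r s : ℕ} (ℓ : Fin (r + 1) → (Fin (n + 1) → ℂ)) (a : Fin (r + 1) → ℕ)
    (hli : LinearIndependent ℂ ℓ) (d : ℕ) (b : Fin s → Fin (n + 1) → ℂ)
    (h : ∏ i, lin (ℓ i) ^ a i = ∑ j, lin (b j) ^ d) :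
    ∃ b' : Fin s → Fin (r + 1) → ℂ,
      ∏ i, (X i : MvPolynomial (Fin (r + 1)) ℂ) ^ a i = ∑ j, lin (b' j) ^ d := by
  classical
  obtain ⟨f, hf⟩ := LinearMap.exists_leftInverse_of_injective
    (Fintype.linearCombination ℂ ℓ) (LinearMap.ker_eq_bot.mpr
      (hli.fintypeLinearCombination_injective))
  have hfl : ∀ i, f (ℓ i) = Pi.single i 1 := by
    intro i
    have := LinearMap.congr_fun hf (Pi.single i 1)
    simpa [Fintype.linearCombination_apply_single] using this
  let φ : MvPolynomial (Fin (n + 1)) ℂ →ₐ[ℂ] MvPolynomial (Fin (r + 1)) ℂ :=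
    aeval (fun t => lin (f (Pi.single t 1)))
  have hφ : ∀ v, φ (lin v) = lin (f v) := by
    intro v
    have hv : v = ∑ t, v t • (Pi.single t (1 : ℂ) : Fin (n + 1) → ℂ) := by
      funext t
      simp [Finset.sum_apply, Pi.single_apply]
    conv_rhs => rw [hv, map_sum]
    simp only [map_smul]
    rw [lin_sum, lin, map_sum]
    simp [φ, MvPolynomial.algebraMap_eq]
  refine ⟨fun j => f (b j), ?_⟩
  have := congrArg φ h
  simpa [map_prod, map_sum, hφ, hfl, lin_single] using this

lemma root_sum (N m : ℕ) (hN : 0 < N) (ζ : ℂ) (hζ : IsPrimitiveRoot ζ N) :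
    ∑ e : Fin N, (ζ ^ (e : ℕ)) ^ m = if N ∣ m then (N : ℂ) else 0 := by
  have : ∑ e : Fin N, (ζ ^ (e : ℕ)) ^ m = ∑ e ∈ Finset.range N, (ζ ^ m) ^ e := by
    rw [Finset.sum_range]
    exact Finset.sum_congr rfl fun e _ => by rw [← pow_mul, ← pow_mul, mul_comm]
  rw [this]
  split_ifs with hd
  · rw [(hζ.pow_eq_one_iff_dvd m).mpr hd]; simp
  · have h1 : ζ ^ m ≠ 1 := fun e => hd ((hζ.pow_eq_one_iff_dvd m).mp e)
    rw [geom_sum_eq h1, ← pow_mul, mul_comm, pow_mul, hζ.pow_eq_one]; simp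

/-- The weights making all the linear combinations isotropic. -/
lemma weights {r n : ℕ} (ℓ : Fin (r + 1) → (Fin (n + 1) → ℂ))
    (hcard : ¬ ∃! i : Fin (r + 1), ¬ Isotropic (ℓ i)) :
    ∃ t : Fin (r + 1) → ℂ, (∀ i, t i ≠ 0) ∧ ∑ i, t i ^ 2 * ∑ k, ℓ i k ^ 2 = 0 := by
  classical
  by_cases hN : ∃ i, ¬ Isotropic (ℓ i)
  · obtain ⟨i0, hi0⟩ := hN
    let S := Finset.univ.filter fun i => ¬ Isotropic (ℓ i) ∧ i ≠ i0
    have hS : S.Nonempty := by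
      by_contra hS
      rw [Finset.not_nonempty_iff_eq_empty, Finset.filter_eq_empty_iff] at hS
      exact hcard ⟨i0, hi0, fun j hj => by
        by_contra hne
        exact hS (Finset.mem_univ j) ⟨hj, hne⟩⟩
    have hsq : ∀ i, ∃ u : ℂ, u ^ 2 = if Isotropic (ℓ i) then 1 else
        if i = i0 then -(S.card : ℂ) / ∑ k, ℓ i k ^ 2 else 1 / ∑ k, ℓ i k ^ 2 := fun i =>
      IsAlgClosed.exists_pow_nat_eq _ (by norm_num)
    choose t ht using hsq
    refine ⟨t, fun i h0 => ?_, ?_⟩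
    · have := ht i
      rw [h0] at this
      have hc : (S.card : ℂ) ≠ 0 := by exact_mod_cast hS.card_pos.ne'
      split_ifs at this with h1 h2
      · simp at this
      · exact (div_ne_zero (neg_ne_zero.mpr hc) h1) (by rw [← this]; simp)
      · exact (one_div_ne_zero h1) (by rw [← this]; simp)
    · have key : ∀ i, t i ^ 2 * ∑ k, ℓ i k ^ 2 =
          (if i = i0 then -(S.card : ℂ) else 0) + (if i ∈ S then 1 else 0) := by
        intro i
        rw [ht]
        by_cases h1 : Isotropic (ℓ i)
        · have h2 : i ≠ i0 := fun e => hi0 (e ▸ h1)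
          have h3 : ∑ k, ℓ i k ^ 2 = 0 := h1
          simp [S, h1, h2, h3]
        · have h3 : ∑ k, ℓ i k ^ 2 ≠ 0 := h1
          by_cases h2 : i = i0
          · rw [if_neg h1, if_pos h2, div_mul_cancel₀ _ h3, if_pos h2]
            simp [S, h2]
          · rw [if_neg h1, if_neg h2, div_mul_cancel₀ _ h3, if_neg h2]
            simp [S, h2, h1]
      rw [Finset.sum_congr rfl fun i _ => key i, Finset.sum_add_distrib]
      simp
  · push Not at hN
    exact ⟨fun _ => 1, by simp, Finset.sum_eq_zero fun i _ => by
      have : ∑ k, ℓ i k ^ 2 = 0 := hN i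
      simp [this]⟩

lemma isotropic_comb {r n : ℕ} (ℓ : Fin (r + 1) → (Fin (n + 1) → ℂ))
    (horth : ∀ i j : Fin (r + 1), i < j → ∑ t, ℓ i t * ℓ j t = 0) (c : Fin (r + 1) → ℂ)
    (hc : ∑ i, c i ^ 2 * ∑ k, ℓ i k ^ 2 = 0) : Isotropic (∑ i, c i • ℓ i) := by
  classical
  have horth' : ∀ i j, i ≠ j → ∑ t, ℓ i t * ℓ j t = 0 := by
    intro i j hij
    rcases lt_or_gt_of_ne hij with h | h
    · exact horth i j h
    · rw [← horth j i h]; exact Finset.sum_congr rfl fun t _ => mul_comm _ _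
  unfold Isotropic
  simp only [Finset.sum_apply, Pi.smul_apply, smul_eq_mul, sq (∑ i, _), Finset.sum_mul_sum]
  rw [Finset.sum_comm, ← hc]
  refine Finset.sum_congr rfl fun i _ => ?_
  rw [Finset.sum_comm, Finset.sum_eq_single i]
  · rw [Finset.mul_sum]; exact Finset.sum_congr rfl fun t _ => by ring
  · intro j _ hj
    have : ∀ t, c i * ℓ i t * (c j * ℓ j t) = c i * c j * (ℓ i t * ℓ j t) := fun t => by ring
    rw [Finset.sum_congr rfl fun t _ => this t, ← Finset.mul_sum, horth' i j hj.symm, mul_zero]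
  · simp

/-- Roots of unity identity. -/
lemma unity_identity {R : Type*} [CommRing R] [Algebra ℂ R] {r : ℕ} (y : Fin (r + 1) → R)
    (a : Fin (r + 1) → ℕ) (hmono : Monotone a) (ζ : Fin r → ℂ)
    (hζ : ∀ i, IsPrimitiveRoot (ζ i) (a i.succ + 1)) :
    ∑ e : (i : Fin r) → Fin (a i.succ + 1), (∏ i, ζ i ^ (e i : ℕ)) •
      (∑ i, (Fin.cons 1 (fun i => ζ i ^ (e i : ℕ)) : Fin (r + 1) → ℂ) i • y i) ^ (∑ i, a i)
    = ((Nat.multinomial Finset.univ a : ℂ) * ∏ i : Fin r, ((a i.succ + 1 : ℕ) : ℂ)) •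
        ∏ i, y i ^ a i := by
  classical
  have h1 : ∀ e : (i : Fin r) → Fin (a i.succ + 1), (∏ i, ζ i ^ (e i : ℕ)) •
      (∑ i, (Fin.cons 1 (fun i => ζ i ^ (e i : ℕ)) : Fin (r + 1) → ℂ) i • y i) ^ (∑ i, a i)
      = ∑ k ∈ Finset.piAntidiag Finset.univ (∑ i, a i),
        ((Nat.multinomial Finset.univ k : ℂ) * ∏ i : Fin r, (ζ i ^ (e i : ℕ)) ^ (k i.succ + 1)) •
          ∏ i, y i ^ k i := by
    intro e
    rw [Finset.sum_pow_eq_sum_piAntidiag, Finset.smul_sum]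
    refine Finset.sum_congr rfl fun k _ => ?_
    have : ∏ i, ((Fin.cons 1 (fun i => ζ i ^ (e i : ℕ)) : Fin (r + 1) → ℂ) i • y i) ^ k i
        = (∏ i : Fin r, (ζ i ^ (e i : ℕ)) ^ (k i.succ)) • ∏ i, y i ^ k i := by
      simp only [Algebra.smul_def, mul_pow, Finset.prod_mul_distrib]
      congr 1
      rw [Fin.prod_univ_succ]
      simp
    rw [this]
    simp only [pow_succ, Finset.prod_mul_distrib, Algebra.smul_def, map_mul, map_natCast]
    ring
  rw [Finset.sum_congr rfl fun e _ => h1 e, Finset.sum_comm]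
  simp only [← Finset.sum_smul, ← Finset.mul_sum]
  have h2 : ∀ k : Fin (r + 1) → ℕ,
      ∑ e : (i : Fin r) → Fin (a i.succ + 1), ∏ i : Fin r, (ζ i ^ (e i : ℕ)) ^ (k i.succ + 1)
      = ∏ i : Fin r, if a i.succ + 1 ∣ k i.succ + 1 then ((a i.succ + 1 : ℕ) : ℂ) else 0 := by
    intro k
    rw [← Finset.prod_congr rfl fun i _ => root_sum (a i.succ + 1) (k i.succ + 1)
      (Nat.succ_pos _) (ζ i) (hζ i)]
    rw [Finset.prod_univ_sum, Fintype.piFinset_univ]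
  simp only [h2]
  rw [Finset.sum_eq_single a]
  · simp
  · intro k hk hka
    simp only [Finset.mem_piAntidiag, Finset.mem_univ, implies_true, and_true] at hk
    have : ∃ i : Fin r, ¬ (a i.succ + 1 ∣ k i.succ + 1) := by
      by_contra hall
      push Not at hall
      apply hka
      have hle : ∀ i : Fin r, a i.succ ≤ k i.succ := fun i => by
        have := Nat.le_of_dvd (Nat.succ_pos _) (hall i); omega
      rw [Fin.sum_univ_succ, Fin.sum_univ_succ] at hk
      have heq : ∀ i : Fin r, k i.succ = a i.succ := by
        intro i
        obtain ⟨q, hq⟩ := hall i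
        have h3 : k i.succ ≤ a i.succ + a 0 := by
          have e1 := Finset.add_sum_erase Finset.univ (fun i : Fin r => k i.succ) (Finset.mem_univ i)
          have e2 := Finset.add_sum_erase Finset.univ (fun i : Fin r => a i.succ) (Finset.mem_univ i)
          have e3 : ∑ x ∈ Finset.univ.erase i, a x.succ ≤ ∑ x ∈ Finset.univ.erase i, k x.succ :=
            Finset.sum_le_sum fun x _ => hle x
          omega
        have h4 : a 0 ≤ a i.succ := hmono (Fin.zero_le _)
        have hq2 : q < 2 := by
          by_contra hq2
          push Not at hq2
          have := Nat.mul_le_mul_left (a i.succ + 1) hq2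
          omega
        interval_cases q <;> omega
      funext i
      refine Fin.cases ?_ heq i
      rw [Finset.sum_congr rfl fun i _ => heq i] at hk
      omega
    obtain ⟨i, hi⟩ := this
    rw [Finset.prod_eq_zero (Finset.mem_univ i) (if_neg hi)]
    simp
  · intro h; exact absurd (by simp) h

lemma upper_s13 (n r : ℕ) (ℓ : Fin (r + 1) → (Fin (n + 1) → ℂ))
    (a : Fin (r + 1) → ℕ)
    (horth : ∀ i j : Fin (r + 1), i < j → ∑ t, ℓ i t * ℓ j t = 0)
    (ha : ∀ i, 1 ≤ a i) (hmono : Monotone a)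
    (hiso : ∀ k, 1 < a k → Isotropic (ℓ k))
    (hcard : ¬ ∃! i : Fin (r + 1), ¬ Isotropic (ℓ i)) :
    ∃ b : ((i : Fin r) → Fin (a i.succ + 1)) → Fin (n + 1) → ℂ, (∀ e, Isotropic (b e)) ∧
      ∏ i, lin (ℓ i) ^ a i = ∑ e, lin (b e) ^ (∑ i, a i) := by
  classical
  obtain ⟨t, ht0, ht⟩ := weights ℓ hcard
  have hd : 0 < ∑ i, a i := Finset.sum_pos (fun i _ => ha i) Finset.univ_nonempty
  let ζ : Fin r → ℂ := fun i => Complex.exp (2 * Real.pi * Complex.I / ((a i.succ + 1 : ℕ) : ℂ))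
  have hζ : ∀ i, IsPrimitiveRoot (ζ i) (a i.succ + 1) := fun i =>
    Complex.isPrimitiveRoot_exp _ (Nat.succ_ne_zero _)
  have hid := unity_identity (fun i => lin (t i • ℓ i)) a hmono ζ hζ
  set M : ℂ := (Nat.multinomial Finset.univ a : ℂ) * ∏ i : Fin r, ((a i.succ + 1 : ℕ) : ℂ) with hM
  set T : ℂ := ∏ i, t i ^ a i with hT
  have hM0 : M ≠ 0 := by
    refine mul_ne_zero (Nat.cast_ne_zero.mpr (Nat.multinomial_pos _ _).ne') ?_
    exact Finset.prod_ne_zero_iff.mpr fun i _ => Nat.cast_ne_zero.mpr (Nat.succ_ne_zero _)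
  have hT0 : T ≠ 0 := Finset.prod_ne_zero_iff.mpr fun i _ => pow_ne_zero _ (ht0 i)
  have hy : ∏ i, lin (t i • ℓ i) ^ a i = T • ∏ i, lin (ℓ i) ^ a i := by
    simp only [lin_smul', mul_pow, Finset.prod_mul_distrib, MvPolynomial.smul_eq_C_mul, hT, map_prod,
      map_pow]
  rw [hy, smul_smul] at hid
  have hroot : ∀ e : (i : Fin r) → Fin (a i.succ + 1), ∃ μ : ℂ,
      μ ^ (∑ i, a i) = (M * T)⁻¹ * ∏ i, ζ i ^ (e i : ℕ) := fun e =>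
    IsAlgClosed.exists_pow_nat_eq _ hd
  choose μ hμ using hroot
  let E : ((i : Fin r) → Fin (a i.succ + 1)) → Fin (r + 1) → ℂ := fun e =>
    Fin.cons 1 (fun i => ζ i ^ (e i : ℕ))
  have hlin : ∀ e, lin (∑ i, (E e i * t i) • ℓ i) = ∑ i, E e i • lin (t i • ℓ i) := by
    intro e
    rw [lin_sum]
    refine Finset.sum_congr rfl fun i _ => ?_
    rw [lin_smul', MvPolynomial.smul_eq_C_mul, C_mul, mul_assoc]
  refine ⟨fun e => μ e • ∑ i, (E e i * t i) • ℓ i, fun e => ?_, ?_⟩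
  · have h1 : Isotropic (∑ i, (E e i * t i) • ℓ i) := by
      apply isotropic_comb ℓ horth
      rw [← ht]
      refine Finset.sum_congr rfl fun i _ => ?_
      by_cases hi : Isotropic (ℓ i)
      · have : ∑ k, ℓ i k ^ 2 = 0 := hi
        rw [this, mul_zero, mul_zero]
      · have hai : a i = 1 := by
          have := ha i
          by_contra hne
          exact hi (hiso i (by omega))
        have hE : E e i ^ 2 = 1 := by
          revert hai
          refine Fin.cases (fun _ => ?_) (fun i hai => ?_) i
          · simp [E]
          · have h2 := (hζ i).pow_eq_one
            rw [hai] at h2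
            simp only [E, Fin.cons_succ]
            rw [← pow_mul, mul_comm, pow_mul, h2, one_pow]
        rw [mul_pow, hE, one_mul]
    unfold Isotropic at h1 ⊢
    simp only [Pi.smul_apply, smul_eq_mul, mul_pow]
    rw [← Finset.mul_sum]
    simp only [smul_eq_mul, Finset.sum_apply, Pi.smul_apply] at h1 ⊢
    rw [h1, mul_zero]
  · have h1 : ∀ e, lin (μ e • ∑ i, (E e i * t i) • ℓ i) ^ (∑ i, a i) =
        (M * T)⁻¹ • ((∏ i, ζ i ^ (e i : ℕ)) • (∑ i, E e i • lin (t i • ℓ i)) ^ (∑ i, a i)) := by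
      intro e
      rw [lin_smul', hlin, mul_pow, ← C_pow, hμ, smul_smul, MvPolynomial.smul_eq_C_mul]
    rw [Finset.sum_congr rfl fun e _ => h1 e, ← Finset.smul_sum, hid, smul_smul,
      inv_mul_cancel₀ (mul_ne_zero hM0 hT0), one_smul]

/-- Isotropic rank of a harmonic monomial: if the number of non-isotropic
linear forms in the monomial is different from one, then
`irk m = ∏_{i=1}^r (aᵢ + 1)`. -/
theorem stmt13 (n r : ℕ) (hn : 1 ≤ n) (ℓ : Fin (r + 1) → (Fin (n + 1) → ℂ))
    (a : Fin (r + 1) → ℕ)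
    (hli : LinearIndependent ℂ ℓ)
    (horth : ∀ i j : Fin (r + 1), i < j → ∑ t, ℓ i t * ℓ j t = 0)
    (ha : ∀ i, 1 ≤ a i) (hmono : Monotone a)
    (hiso : ∀ k, 1 < a k → Isotropic (ℓ k))
    (hcard : ¬ ∃! i : Fin (r + 1), ¬ Isotropic (ℓ i)) :
    irk (∑ i, a i) (∏ i, (lin (ℓ i)) ^ (a i)) = ∏ i : Fin r, (a i.succ + 1) := by
  classical
  have hmem : (∏ i : Fin r, (a i.succ + 1)) ∈ {s : ℕ | ∃ b : Fin s → (Fin (n + 1) → ℂ),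
      (∀ j, Isotropic (b j)) ∧ ∏ i, (lin (ℓ i)) ^ (a i) = ∑ j, (lin (b j)) ^ (∑ i, a i)} := by
    obtain ⟨b, hb, h⟩ := upper_s13 n r ℓ a horth ha hmono hiso hcard
    have hc : Fintype.card ((i : Fin r) → Fin (a i.succ + 1)) = ∏ i : Fin r, (a i.succ + 1) := by
      simp [Fintype.card_pi]
    let φ := Fintype.equivFinOfCardEq hc
    refine ⟨fun j => b (φ.symm j), fun j => hb _, ?_⟩
    rw [h]
    exact (Equiv.sum_comp φ.symm (fun e => lin (b e) ^ (∑ i, a i))).symm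
  unfold irk
  apply le_antisymm
  · exact Nat.sInf_le hmem
  · apply le_csInf ⟨_, hmem⟩
    rintro s ⟨b, -, h⟩
    obtain ⟨b', h'⟩ := reduce ℓ a hli _ b h
    exact lower_s13 a (ha 0) b' h'
end

section
/- Let n ≥ 1, r ≥ 1, let ℓ_0,…,ℓ_r be linearly independent, pairwise orthogonal linear forms in ℂ[x_0,…,x_n] such that ℓ_0 is NOT isotropic and ℓ_1,…,ℓ_r are isotropic, and let 1 = a_0 ≤ a_1 ≤ … ≤ a_r be integers. Then the monomial m = ℓ_0·ℓ_1^{a_1}·…·ℓ_r^{a_r} is harmonic and irk(m) = 2·∏_{i=1}^r (a_i + 1). -/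
open MvPolynomial

lemma aeval_lin {n : ℕ} {κ : Type*} [Fintype κ] (F : (Fin n → ℂ) →ₗ[ℂ] (κ → ℂ)) (v : Fin n → ℂ) :
    aeval (fun t => ∑ k, F (Pi.single t 1) k • (X k : MvPolynomial κ ℂ)) (lin v)
      = ∑ k, F v k • X k := by
  have hv : v = ∑ t, v t • (Pi.single t 1 : Fin n → ℂ) := by
    ext s
    simp [Finset.sum_apply, Pi.single_apply]
  conv_rhs => rw [hv]
  simp only [lin, map_sum, map_mul, aeval_X, map_smul, Finset.sum_apply, Pi.smul_apply,
    Finset.sum_smul, algHom_C, MvPolynomial.algebraMap_eq]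
  rw [Finset.sum_comm]
  refine Finset.sum_congr rfl fun t _ => ?_
  rw [Finset.mul_sum]
  refine Finset.sum_congr rfl fun k _ => ?_
  rw [smul_eq_mul, mul_smul, C_mul']

lemma Lam_key {n r N : ℕ} (ℓ : Fin (r + 1) → (Fin (n + 1) → ℂ)) (a : Fin (r + 1) → ℕ)
    (g : (Fin (n + 1) → ℂ) →ₗ[ℂ] (Fin (r + 1) → ℂ)) (hg : ∀ i, g (ℓ i) = Pi.single i 1)
    (z : (Fin (n + 1) → ℂ) →ₗ[ℂ] ℂ) (hz : ∀ i, z (ℓ i) = 0)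
    (v : Fin N → (Fin (n + 1) → ℂ))
    (h : ∏ i, (lin (ℓ i)) ^ (a i) = ∑ j, (lin (v j)) ^ (∑ i, a i))
    (c : Fin (r + 1) → ℕ) (e : ℕ) (hd : ∑ i, c i + e = ∑ i, a i) :
    ∃ M : ℂ, M ≠ 0 ∧ M * ∑ j, (∏ i, g (v j) i ^ c i) * z (v j) ^ e
      = if c = a ∧ e = 0 then 1 else 0 := by
  classical
  let F : (Fin (n + 1) → ℂ) →ₗ[ℂ] (Option (Fin (r + 1)) → ℂ) :=
    LinearMap.pi (fun o => o.elim z (fun i => LinearMap.proj i ∘ₗ g))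
  have hF0 : ∀ w, F w none = z w := fun w => rfl
  have hF1 : ∀ w i, F w (some i) = g w i := fun w i => rfl
  let s : Option (Fin (r + 1)) →₀ ℕ := Finsupp.equivFunOnFinite.symm (fun o => o.elim e c)
  let s' : Option (Fin (r + 1)) →₀ ℕ := Finsupp.equivFunOnFinite.symm (fun o => o.elim 0 a)
  have h2 := congrArg (fun p => coeff s
    (aeval (fun t => ∑ k, F (Pi.single t 1) k • (X k : MvPolynomial _ ℂ)) p)) h
  simp only [map_prod, map_pow, map_sum, aeval_lin, coeff_sum,
    coeff_linearCombination_X_pow_of_fintype] at h2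
  have hs : (s.sum fun x m => m) = ∑ i, a i := by
    rw [Finsupp.sum_fintype _ _ (by simp)]
    simp [s, Fintype.sum_option, ← hd, add_comm]
  have hl : ∀ i, ∑ k, F (ℓ i) k • (X k : MvPolynomial (Option (Fin (r+1))) ℂ) = X (some i) := by
    intro i
    simp [Fintype.sum_option, hF0, hF1, hz, hg, Pi.single_apply]
  have hp : (∏ i, (X (some i) : MvPolynomial (Option (Fin (r+1))) ℂ) ^ a i) = monomial s' 1 := by
    rw [monomial_eq, Finsupp.prod_fintype _ _ (by simp)]
    simp [s', Fintype.prod_option]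
  simp only [hl, hp, hs, if_true, coeff_monomial] at h2
  refine ⟨(s.multinomial : ℂ), ?_, ?_⟩
  · exact_mod_cast (Nat.multinomial_pos _ _).ne'
  · rw [Finset.mul_sum]
    have hss : s' = s ↔ (c = a ∧ e = 0) := by
      constructor
      · intro hh
        have := fun o => DFunLike.congr_fun hh o
        refine ⟨funext fun i => ?_, ?_⟩
        · simpa [s, s'] using (this (some i)).symm
        · simpa [s, s'] using (this none).symm
      · rintro ⟨rfl, rfl⟩; rfl
    simp only [hss] at h2
    rw [h2]
    refine Finset.sum_congr rfl fun j _ => ?_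
    congr 1
    rw [Finsupp.prod_fintype _ _ (by simp)]
    simp [s, Fintype.prod_option, hF0, hF1, mul_comm]

lemma exists_g {n r : ℕ} (ℓ : Fin (r + 1) → (Fin (n + 1) → ℂ)) (hli : LinearIndependent ℂ ℓ) :
    ∃ g : (Fin (n + 1) → ℂ) →ₗ[ℂ] (Fin (r + 1) → ℂ), ∀ i, g (ℓ i) = Pi.single i 1 := by
  classical
  have := LinearMap.exists_leftInverse_of_injective (Fintype.linearCombination ℂ ℓ)
    (LinearMap.ker_eq_bot.2 (linearIndependent_iff_injective_fintypeLinearCombination.1 hli))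
  obtain ⟨g, hg⟩ := this
  refine ⟨g, fun i => ?_⟩
  have := LinearMap.congr_fun hg (Pi.single i 1)
  simpa using this

lemma dot_span {n r : ℕ} (ℓ : Fin (r + 1) → (Fin (n + 1) → ℂ))
    (horth : ∀ i j : Fin (r + 1), i < j → ∑ t, ℓ i t * ℓ j t = 0)
    (h0 : ¬ Isotropic (ℓ 0))
    (hiso : ∀ i : Fin (r + 1), i ≠ 0 → Isotropic (ℓ i)) :
    ∃ c : ℂ, c ≠ 0 ∧ ∀ i j : Fin (r + 1), ℓ i ⬝ᵥ ℓ j = if i = 0 ∧ j = 0 then c else 0 := by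
  refine ⟨ℓ 0 ⬝ᵥ ℓ 0, ?_, ?_⟩
  · intro h
    exact h0 (by simpa [Isotropic, dotProduct, ← pow_two] using h)
  · intro i j
    rcases lt_trichotomy i j with h | h | h
    · have hj : j ≠ 0 := by rintro rfl; simp at h
      simp [hj, dotProduct, horth i j h]
    · subst h
      by_cases hi : i = 0
      · simp [hi]
      · have := hiso i hi
        simp only [Isotropic] at this
        simp [hi, dotProduct, ← pow_two, this]
    · have hj : i ≠ 0 := by rintro rfl; simp at h
      rw [dotProduct_comm]
      simp [hj, dotProduct, horth j i h]

lemma lower_bound {n r N : ℕ} (ℓ : Fin (r + 1) → (Fin (n + 1) → ℂ)) (a : Fin (r + 1) → ℕ)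
    (hli : LinearIndependent ℂ ℓ)
    (horth : ∀ i j : Fin (r + 1), i < j → ∑ t, ℓ i t * ℓ j t = 0)
    (h0 : ¬ Isotropic (ℓ 0))
    (hiso : ∀ i : Fin (r + 1), i ≠ 0 → Isotropic (ℓ i))
    (ha0 : a 0 = 1)
    (v : Fin N → (Fin (n + 1) → ℂ)) (hv : ∀ j, Isotropic (v j))
    (h : ∏ i, (lin (ℓ i)) ^ (a i) = ∑ j, (lin (v j)) ^ (∑ i, a i)) :
    2 * ∏ i : Fin r, (a i.succ + 1) ≤ N := by
  classical
  obtain ⟨g, hg⟩ := exists_g ℓ hli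
  obtain ⟨c0, hc0, hdot⟩ := dot_span ℓ horth h0 hiso
  let S := Submodule.span ℂ (Set.range ℓ)
  obtain ⟨z0, hz0⟩ := Module.exists_dual_forall_apply_ne_zero (K := ℂ)
    (fun j : {j : Fin N // v j ∉ S} => S.mkQ (v j))
    (fun j => by simpa using j.2)
  let z : (Fin (n + 1) → ℂ) →ₗ[ℂ] ℂ := z0 ∘ₗ S.mkQ
  have hzS : ∀ w ∈ S, z w = 0 := by
    intro w hw
    have : S.mkQ w = 0 := by simpa using hw
    simp only [z, LinearMap.comp_apply, this, map_zero]
  have hzl : ∀ i, z (ℓ i) = 0 := fun i => hzS _ (Submodule.subset_span ⟨i, rfl⟩)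
  have hzv : ∀ j, v j ∉ S → z (v j) ≠ 0 := fun j hj => hz0 ⟨j, hj⟩
  have hgS : ∀ j, v j ∈ S → g (v j) 0 = 0 := by
    intro j hj
    obtain ⟨s, hs⟩ := (Submodule.mem_span_range_iff_exists_fun ℂ).1 hj
    have h1 : g (v j) 0 = s 0 := by
      rw [← hs]
      simp [hg, Pi.single_apply]
    have h2 : v j ⬝ᵥ v j = s 0 * s 0 * c0 := by
      rw [← hs]
      simp only [sum_dotProduct, dotProduct_sum, smul_dotProduct, dotProduct_smul, hdot,
        smul_eq_mul]
      rw [Finset.sum_eq_single 0 (by intro b _ hb; simp [hb]) (by simp),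
        Finset.sum_eq_single 0 (by intro b _ hb; simp [hb]) (by simp)]
      rw [if_pos ⟨rfl, rfl⟩]; ring
    have h3 : v j ⬝ᵥ v j = 0 := by
      simpa [Isotropic, dotProduct, ← pow_two] using hv j
    rw [h3] at h2
    rw [h1]
    have := h2.symm
    simpa [hc0] using this
  have hsum : ∀ (c : Fin (r+1) → ℕ) (e : ℕ), (c 0 ≠ 0 ∨ e ≠ 0) →
      ∑ j : {j : Fin N // v j ∉ S}, (∏ i, g (v j) i ^ c i) * z (v j) ^ e
        = ∑ j, (∏ i, g (v j) i ^ c i) * z (v j) ^ e := by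
    intro c e hce
    rw [← Finset.sum_subtype (Finset.univ.filter (fun j => v j ∉ S)) (by simp)
      (fun j => (∏ i, g (v j) i ^ c i) * z (v j) ^ e)]
    refine Finset.sum_subset (Finset.subset_univ _) fun j _ hj => ?_
    have hj : v j ∈ S := by simpa using hj
    rcases hce with hc | he
    · rw [Finset.prod_eq_zero (Finset.mem_univ 0), zero_mul]
      rw [hgS j hj, zero_pow hc]
    · rw [hzS _ hj, zero_pow he, mul_zero]
  let B := (i : Fin (r+1)) → Fin (a i + 1)
  let w : B → ({j : Fin N // v j ∉ S} → ℂ) := fun b j =>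
    (∏ i, g (v j) i ^ (b i : ℕ)) * ((z (v j))⁻¹) ^ (∑ i, (b i : ℕ))
  have hw : LinearIndependent ℂ w := by
    rw [Fintype.linearIndependent_iff]
    intro γ hγ
    by_contra hne
    push Not at hne
    obtain ⟨b1, hb1⟩ := hne
    obtain ⟨b, hb, hmax⟩ := Finset.exists_max_image (Finset.univ.filter (fun b : B => γ b ≠ 0))
      (fun b => 2 * ∑ i, (b i : ℕ) - (b 0 : ℕ)) ⟨b1, by simpa using hb1⟩
    simp only [Finset.mem_filter, Finset.mem_univ, true_and] at hb hmax
    have hle0 : ∀ b : B, (b 0 : ℕ) ≤ 1 := fun b => by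
      have := (b 0).2
      omega
    have hleS : ∀ b : B, (b 0 : ℕ) ≤ ∑ i, (b i : ℕ) := fun b =>
      Finset.single_le_sum (f := fun i => (b i : ℕ)) (by simp) (Finset.mem_univ 0)
    have hba : ∀ (b : B) i, (b i : ℕ) ≤ a i := fun b i => Nat.lt_succ_iff.1 (b i).2
    have hkey : ∀ b', γ b' ≠ 0 → (∑ i, (b' i : ℕ) < ∑ i, (b i : ℕ)) ∨
        (∑ i, (b' i : ℕ) = ∑ i, (b i : ℕ) ∧ (b 0 : ℕ) ≤ b' 0) := by
      intro b' hb'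
      have := hmax b' hb'
      have h1 := hle0 b
      have h2 := hle0 b'
      have h3 := hleS b
      have h4 := hleS b'
      omega
    have hpair : ∑ b' : B, γ b' * ∑ j : {j : Fin N // v j ∉ S},
        (∏ i, g (v j) i ^ ((b' i : ℕ) + (a i - b i))) *
          z (v j) ^ (∑ i, (b i : ℕ) - ∑ i, (b' i : ℕ)) = 0 := by
      have : ∑ j : {j : Fin N // v j ∉ S}, (∑ b', γ b' • w b') j *
          ((∏ i, g (v j) i ^ (a i - b i)) * z (v j) ^ (∑ i, (b i : ℕ))) = 0 := by
        rw [hγ]; simp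
      rw [← this]
      simp only [Finset.sum_apply, Finset.sum_mul, Finset.mul_sum]
      rw [Finset.sum_comm]
      refine Finset.sum_congr rfl fun j _ => Finset.sum_congr rfl fun b' _ => ?_
      by_cases hb' : γ b' = 0
      · simp [hb']
      have hle : ∑ i, (b' i : ℕ) ≤ ∑ i, (b i : ℕ) := by
        rcases hkey b' hb' with h | h <;> omega
      have hz' := hzv j j.2
      simp only [Pi.smul_apply, smul_eq_mul, w, pow_add, Finset.prod_mul_distrib]
      rw [pow_sub₀ _ hz' hle, inv_pow]
      ring
    rw [Finset.sum_eq_single b] at hpair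
    · have hab : (fun i => (b i : ℕ) + (a i - b i)) = a := by
        funext i; have := hba b i; omega
      have h1 := hsum (fun i => (b i : ℕ) + (a i - b i)) 0 (Or.inl (by
        have := congrFun hab 0
        simp only [ha0] at this ⊢
        omega))
      obtain ⟨M, hM, hM2⟩ := Lam_key ℓ a g hg z hzl v h (fun i => (b i : ℕ) + (a i - b i)) 0
        (by simp only [hab, add_zero])
      rw [Nat.sub_self, h1] at hpair
      rw [← h1] at hM2
      rw [if_pos ⟨hab, rfl⟩] at hM2
      rcases mul_eq_zero.1 hpair with h | h
      · exact hb h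
      · rw [← h1] at h
        rw [h] at hM2; simp at hM2
    · intro b' _ hbb
      by_cases hb' : γ b' = 0
      · simp [hb']
      have hk := hkey b' hb'
      have h1 := hsum (fun i => (b' i : ℕ) + (a i - b i)) (∑ i, (b i : ℕ) - ∑ i, (b' i : ℕ)) (by
        rcases hk with h | h
        · right; omega
        · left
          by_cases h5 : (b 0 : ℕ) = 0
          · simp [h5, ha0]
          · dsimp; omega)
      have hs3 : ∑ i, (a i - (b i : ℕ)) + ∑ i, (b i : ℕ) = ∑ i, a i := by
        rw [← Finset.sum_add_distrib]
        exact Finset.sum_congr rfl fun i _ => Nat.sub_add_cancel (hba b i)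
      obtain ⟨M, hM, hM2⟩ := Lam_key ℓ a g hg z hzl v h (fun i => (b' i : ℕ) + (a i - b i))
        (∑ i, (b i : ℕ) - ∑ i, (b' i : ℕ)) (by
          rw [Finset.sum_add_distrib]
          rcases hk with h | h <;> omega)
      rw [h1]
      rw [if_neg] at hM2
      · rcases mul_eq_zero.1 hM2 with h | h
        · exact absurd h hM
        · rw [h, mul_zero]
      · rintro ⟨h6, h7⟩
        apply hbb
        funext i
        have := congrFun h6 i
        have h8 := hba b i
        apply Fin.ext
        omega
    · simp
  have := hw.fintype_card_le_finrank
  rw [Module.finrank_fintype_fun_eq_card] at this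
  have hB : Fintype.card B = 2 * ∏ i : Fin r, (a i.succ + 1) := by
    simp [B, Fin.prod_univ_succ, ha0]
  rw [← hB]
  refine this.trans ?_
  have := Fintype.card_subtype_le (fun j : Fin N => v j ∉ S)
  rwa [Fintype.card_fin] at this

lemma sum_root {N : ℕ} (ζ : ℂ) (hζ : IsPrimitiveRoot ζ N) (d : ℕ) (h1 : 0 < d) (h2 : d < N) :
    ∑ j : Fin N, (ζ ^ d) ^ (j : ℕ) = 0 := by
  rw [Fin.sum_univ_eq_sum_range (fun j => (ζ ^ d) ^ j) N]
  have h := mul_geom_sum (ζ ^ d) N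
  rw [← pow_mul, mul_comm d N, pow_mul, hζ.pow_eq_one, one_pow, sub_self] at h
  rcases mul_eq_zero.1 h with h | h
  · exact absurd (sub_eq_zero.1 h) (hζ.pow_ne_one_of_pos_of_lt h1.ne' h2)
  · exact h

lemma root_filter {r : ℕ} (a : Fin r → ℕ) (ζ : Fin r → ℂ)
    (hζ : ∀ i, IsPrimitiveRoot (ζ i) (a i + 1)) (P : MvPolynomial (Fin r) ℂ)
    (hP : P.totalDegree ≤ ∑ i, a i) :
    ∑ j : ((i : Fin r) → Fin (a i + 1)), (∏ i, ζ i ^ (j i : ℕ)) *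
      eval (fun i => ζ i ^ (j i : ℕ)) P
      = (∏ i, ((a i : ℂ) + 1)) * coeff (Finsupp.equivFunOnFinite.symm a) P := by
  classical
  simp only [eval_eq', Finset.mul_sum]
  rw [Finset.sum_comm]
  have key : ∀ d ∈ P.support, ∑ j : ((i : Fin r) → Fin (a i + 1)), (∏ i, ζ i ^ (j i : ℕ)) *
      (coeff d P * ∏ i, (ζ i ^ (j i : ℕ)) ^ d i) =
      if d = Finsupp.equivFunOnFinite.symm a then (∏ i, ((a i : ℂ) + 1)) * coeff d P else 0 := by
    intro d hd
    have h1 : ∑ j : ((i : Fin r) → Fin (a i + 1)), (∏ i, ζ i ^ (j i : ℕ)) *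
      (coeff d P * ∏ i, (ζ i ^ (j i : ℕ)) ^ d i) =
        coeff d P * ∏ i, ∑ j : Fin (a i + 1), (ζ i ^ (d i + 1)) ^ (j : ℕ) := by
      rw [Finset.prod_univ_sum, Fintype.piFinset_univ, Finset.mul_sum]
      refine Finset.sum_congr rfl fun j _ => ?_
      rw [mul_left_comm, ← Finset.prod_mul_distrib]
      congr 1
      refine Finset.prod_congr rfl fun i _ => ?_
      rw [← pow_mul, ← pow_add, ← pow_mul]
      congr 1; ring
    rw [h1]
    split_ifs with hda
    · rw [mul_comm]
      congr 1
      refine Finset.prod_congr rfl fun i _ => ?_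
      simp [hda, (hζ i).pow_eq_one]
    · have hdeg : ∑ i, d i ≤ ∑ i, a i := by
        have := (le_totalDegree hd).trans hP
        rwa [Finsupp.sum_fintype _ _ (by simp)] at this
      obtain ⟨i, hi⟩ : ∃ i, d i < a i := by
        by_contra hcon
        push Not at hcon
        apply hda
        have := (Finset.sum_eq_sum_iff_of_le (s := Finset.univ) (f := a) (g := d)
          (fun i _ => hcon i)).1 (le_antisymm (Finset.sum_le_sum fun i _ => hcon i) hdeg)
        ext i
        simpa using (this i (Finset.mem_univ i)).symm
      rw [Finset.prod_eq_zero (Finset.mem_univ i), mul_zero]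
      exact sum_root _ (hζ i) _ (by omega) (by omega)
  rw [Finset.sum_congr rfl key, Finset.sum_ite_eq']
  split_ifs with h
  · rfl
  · rw [notMem_support_iff.1 h, mul_zero]

lemma coeff_top {r : ℕ} (a : Fin r → ℕ) (κ : ℂ) (l : Fin r → ℂ) :
    coeff (Finsupp.equivFunOnFinite.symm a) ((C κ + ∑ i, l i • X i) ^ (∑ i, a i)) =
      ((Finsupp.equivFunOnFinite.symm a).multinomial : ℂ) * ∏ i, l i ^ a i := by
  have hs : ((Finsupp.equivFunOnFinite.symm a).sum fun x m => m) = ∑ i, a i := by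
    rw [Finsupp.sum_fintype _ _ (by simp)]
    simp
  rw [add_comm, add_pow, coeff_sum, Finset.sum_eq_single (∑ i, a i)]
  · simp only [Nat.sub_self, pow_zero, mul_one, Nat.choose_self, Nat.cast_one,
      coeff_linearCombination_X_pow_of_fintype]
    rw [if_pos hs, Finsupp.prod_fintype _ _ (by simp)]
    simp
  · intro m hm hne
    have : (∑ i, l i • X i) ^ m * C κ ^ (∑ i, a i - m) * (((∑ i, a i).choose m : ℕ) :
        MvPolynomial (Fin r) ℂ) = C (κ ^ (∑ i, a i - m) * ((∑ i, a i).choose m : ℕ)) *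
        (∑ i, l i • X i) ^ m := by
      simp only [map_mul, map_pow, map_natCast]; ring
    rw [this, coeff_C_mul, coeff_linearCombination_X_pow_of_fintype, if_neg, mul_zero]
    rw [hs]; exact hne.symm
  · simp

lemma totalDegree_linform_le {r : ℕ} (κ : ℂ) (l : Fin r → ℂ) :
    (C κ + ∑ i, l i • X i : MvPolynomial (Fin r) ℂ).totalDegree ≤ 1 := by
  refine (totalDegree_add _ _).trans (max_le (by simp) ?_)
  refine totalDegree_finsetSum_le fun i _ => (totalDegree_smul_le _ _).trans ?_
  simp

lemma term_degree {r : ℕ} (t : ℂ) (κ : ℂ) (l e : Fin r → ℂ) (p q : ℕ) :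
    (C t * ((∑ i, e i • X i) ^ p * (C κ + ∑ i, l i • X i) ^ q) :
      MvPolynomial (Fin r) ℂ).totalDegree ≤ p + q := by
  refine (totalDegree_mul _ _).trans ?_
  rw [totalDegree_C, zero_add]
  refine (totalDegree_mul _ _).trans ?_
  refine add_le_add ((totalDegree_pow _ _).trans ?_) ((totalDegree_pow _ _).trans ?_)
  · have := totalDegree_linform_le 0 e
    rw [map_zero, zero_add] at this
    simpa using Nat.mul_le_mul_left p this
  · simpa using Nat.mul_le_mul_left q (totalDegree_linform_le κ l)

lemma upper_identity {r : ℕ} (a : Fin r → ℕ) (ζ : Fin r → ℂ)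
    (hζ : ∀ i, IsPrimitiveRoot (ζ i) (a i + 1)) (e : Fin r → ℂ) :
    ∃ K : ℂ, K ≠ 0 ∧ ∀ y : ((i : Fin r) → Fin (a i + 1)) → ℂ, (∀ j, y j ≠ 0) →
      (∀ j, y j ^ 2 = ∑ i, e i * ζ i ^ (j i : ℕ)) → ∀ (κ L : ℂ) (l : Fin r → ℂ),
      ∑ j : ((i : Fin r) → Fin (a i + 1)), (∏ i, ζ i ^ (j i : ℕ)) * (y j)⁻¹ *
        ((κ + ∑ i, l i * ζ i ^ (j i : ℕ) + y j * L) ^ (∑ i, a i + 1)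
          - (κ + ∑ i, l i * ζ i ^ (j i : ℕ) - y j * L) ^ (∑ i, a i + 1))
        = K * (L * ∏ i, l i ^ a i) := by
  classical
  set s : Fin r →₀ ℕ := Finsupp.equivFunOnFinite.symm a with hsdef
  have hssum : ∑ i ∈ s.support, s i = ∑ i, a i := by
    have := Finsupp.sum_fintype s (fun _ m => m) (by simp)
    simpa [Finsupp.sum, hsdef] using this
  refine ⟨(∏ i, ((a i : ℂ) + 1)) * (2 * ((∑ i, a i + 1 : ℕ) : ℂ) * (s.multinomial : ℂ)), ?_, ?_⟩
  · refine mul_ne_zero (Finset.prod_ne_zero_iff.2 fun i _ => ?_) (mul_ne_zero (mul_ne_zero ?_ ?_) ?_)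
    · exact_mod_cast Nat.succ_ne_zero (a i)
    · norm_num
    · exact_mod_cast Nat.succ_ne_zero (∑ i, a i)
    · exact_mod_cast (Nat.multinomial_pos _ _).ne'
  intro y hy hy2 κ L l
  set D := ∑ i, a i with hD
  let T : ℕ → MvPolynomial (Fin r) ℂ := fun m =>
    if Odd m then C (2 * ((D + 1).choose m : ℂ) * L ^ m) *
      ((∑ i, e i • X i) ^ (m / 2) * (C κ + ∑ i, l i • X i) ^ (D + 1 - m)) else 0
  let P := ∑ m ∈ Finset.range (D + 2), T m
  have hT : ∀ m ∈ Finset.range (D + 2), (T m).totalDegree ≤ D ∧ (m ≠ 1 → coeff s (T m) = 0) := by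
    intro m hm
    rw [Finset.mem_range] at hm
    by_cases ho : Odd m
    · have h1 : (T m).totalDegree ≤ m / 2 + (D + 1 - m) := by
        simp only [T, if_pos ho]; exact term_degree _ _ _ _ _ _
      obtain ⟨q, rfl⟩ := ho
      refine ⟨h1.trans (by omega), fun hne => ?_⟩
      apply coeff_eq_zero_of_totalDegree_lt
      rw [hssum]
      exact lt_of_le_of_lt h1 (by omega)
    · simp [T, if_neg ho]
  have hPdeg : P.totalDegree ≤ ∑ i, a i := totalDegree_finsetSum_le fun m hm => (hT m hm).1
  have hPc : coeff s P = 2 * ((D + 1 : ℕ) : ℂ) * (s.multinomial : ℂ) * (L * ∏ i, l i ^ a i) := by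
    simp only [P, coeff_sum]
    rw [Finset.sum_eq_single 1 (fun m hm hne => (hT m hm).2 hne) (by simp)]
    simp only [T, if_pos odd_one, coeff_C_mul]
    norm_num
    rw [hsdef, hD, coeff_top]
    ring
  have hmain := root_filter a ζ hζ P hPdeg
  rw [← hsdef, hPc] at hmain
  rw [mul_assoc, ← hmain]
  refine Finset.sum_congr rfl fun j _ => ?_
  rw [mul_assoc]
  congr 1
  rw [inv_mul_eq_iff_eq_mul₀ (hy j)]
  have hA : eval (fun i => ζ i ^ (j i : ℕ)) (C κ + ∑ i, l i • X i) =
    κ + ∑ i, l i * ζ i ^ (j i : ℕ) := by simp [smul_eval]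
  have hE : eval (fun i => ζ i ^ (j i : ℕ)) (∑ i, e i • X i) = y j ^ 2 := by
    rw [hy2]; simp [smul_eval]
  simp only [P, map_sum]
  rw [add_comm _ (y j * L), sub_eq_add_neg _ (y j * L), add_comm _ (-(y j * L)),
    add_pow, add_pow, ← Finset.sum_sub_distrib, Finset.mul_sum]
  refine Finset.sum_congr rfl fun m _ => ?_
  by_cases ho : Odd m
  · simp only [T, if_pos ho, map_mul, map_pow, hA, hE, eval_C]
    obtain ⟨q, rfl⟩ := ho
    rw [Odd.neg_pow ⟨q, rfl⟩, ← pow_mul]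
    have : (2 * q + 1) / 2 = q := by omega
    rw [this]
    ring
  · simp only [T, if_neg ho, map_zero, mul_zero]
    rw [Even.neg_pow (Nat.not_odd_iff_even.1 ho), sub_self]

lemma eval_lin {n : ℕ} (x v : Fin n → ℂ) : eval x (lin v) = v ⬝ᵥ x := by
  simp [lin, dotProduct]

lemma upper_bound {n r : ℕ} (hr : 1 ≤ r) (ℓ : Fin (r + 1) → (Fin (n + 1) → ℂ))
    (a : Fin (r + 1) → ℕ)
    (hli : LinearIndependent ℂ ℓ)
    (horth : ∀ i j : Fin (r + 1), i < j → ∑ t, ℓ i t * ℓ j t = 0)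
    (h0 : ¬ Isotropic (ℓ 0))
    (hiso : ∀ i : Fin (r + 1), i ≠ 0 → Isotropic (ℓ i))
    (ha0 : a 0 = 1) :
    ∃ v : Fin (2 * ∏ i : Fin r, (a i.succ + 1)) → (Fin (n + 1) → ℂ),
      (∀ j, Isotropic (v j)) ∧
      ∏ i, (lin (ℓ i)) ^ (a i) = ∑ j, (lin (v j)) ^ (∑ i, a i) := by
  classical
  obtain ⟨g, hg⟩ := exists_g ℓ hli
  obtain ⟨c0, hc0, hdot⟩ := dot_span ℓ horth h0 hiso
  let J := (i : Fin r) → Fin (a i.succ + 1)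
  let ζ : Fin r → ℂ := fun i => Complex.exp (2 * Real.pi * Complex.I / ((a i.succ + 1 : ℕ) : ℂ))
  have hζ : ∀ i, IsPrimitiveRoot (ζ i) (a i.succ + 1) := fun i =>
    Complex.isPrimitiveRoot_exp _ (Nat.succ_ne_zero _)
  let ω : J → Fin r → ℂ := fun j i => ζ i ^ (j i : ℕ)
  obtain ⟨f, hf⟩ := Module.exists_dual_forall_apply_ne_zero (K := ℂ) ω (by
    intro j h
    have := congrFun h ⟨0, hr⟩
    exact pow_ne_zero _ ((hζ _).ne_zero (Nat.succ_ne_zero _)) this)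
  let c : Fin r → ℂ := fun i => f (Pi.single i 1)
  have hfc : ∀ w, f w = ∑ i, c i * w i := by
    intro w
    have hw : w = ∑ t, w t • (Pi.single t 1 : Fin r → ℂ) := by
      ext s
      simp [Finset.sum_apply, Pi.single_apply]
    conv_lhs => rw [hw]
    simp [c, mul_comm]
  let k' : Fin (n + 1) → ℂ := fun t => ∑ i : Fin r, c i * g (Pi.single t 1) i.succ
  have hk' : ∀ w, k' ⬝ᵥ w = ∑ i : Fin r, c i * g w i.succ := by
    intro w
    have hw : w = ∑ t, w t • (Pi.single t 1 : Fin (n+1) → ℂ) := by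
      ext s
      simp [Finset.sum_apply, Pi.single_apply]
    conv_rhs => rw [hw]
    simp only [dotProduct, k', map_sum, map_smul, Finset.sum_apply, Pi.smul_apply, smul_eq_mul,
      Finset.mul_sum, Finset.sum_mul]
    rw [Finset.sum_comm]
    refine Finset.sum_congr rfl fun t _ => Finset.sum_congr rfl fun i _ => ?_
    ring
  have hk'0 : k' ⬝ᵥ ℓ 0 = 0 := by
    rw [hk', hg]; simp
  have hk's : ∀ i : Fin r, k' ⬝ᵥ ℓ i.succ = c i := by
    intro i
    rw [hk', hg]; simp [Pi.single_apply]
  let u : J → Fin (n + 1) → ℂ := fun j => ∑ i : Fin r, ω j i • ℓ i.succ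
  have huS : ∀ j (i : Fin (r+1)), u j ⬝ᵥ ℓ i = 0 := by
    intro j i
    simp [u, sum_dotProduct, smul_dotProduct, hdot]
  have huu : ∀ j j', u j ⬝ᵥ u j' = 0 := by
    intro j j'
    conv_lhs => rw [show u j' = ∑ i : Fin r, ω j' i • ℓ i.succ from rfl]
    simp [dotProduct_sum, dotProduct_smul, huS]
  have hk'u : ∀ j, k' ⬝ᵥ u j = f (ω j) := by
    intro j
    rw [hfc]
    simp [u, dotProduct_sum, dotProduct_smul, hk's, mul_comm]
  let j0 : J := fun i => 0
  let k : Fin (n+1) → ℂ := k' - ((k' ⬝ᵥ k') / (2 * f (ω j0))) • u j0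
  have hkk : k ⬝ᵥ k = 0 := by
    have := hf j0
    simp only [k, sub_dotProduct, dotProduct_sub, smul_dotProduct, dotProduct_smul, huu,
      dotProduct_comm (u j0) k', hk'u, smul_eq_mul]
    field_simp
    ring
  have hk0 : k ⬝ᵥ ℓ 0 = 0 := by
    simp only [k, sub_dotProduct, smul_dotProduct, huS, hk'0]; simp
  have hku : ∀ j, k ⬝ᵥ u j = f (ω j) := by
    intro j
    simp only [k, sub_dotProduct, smul_dotProduct, huu, hk'u]; simp
  have hy : ∀ j : J, ∃ y : ℂ, y ≠ 0 ∧ y ^ 2 = ∑ i, (-2 * c i / c0) * ω j i := by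
    intro j
    obtain ⟨y, hy⟩ := IsAlgClosed.exists_pow_nat_eq (∑ i, (-2 * c i / c0) * ω j i) (n := 2) (by norm_num)
    refine ⟨y, ?_, hy⟩
    rintro rfl
    apply hf j
    have h1 : ∑ i, (-2 * c i / c0) * ω j i = (-2 / c0) * f (ω j) := by
      rw [hfc, Finset.mul_sum]
      exact Finset.sum_congr rfl fun i _ => by ring
    rw [h1] at hy
    simpa [hc0] using hy.symm
  choose y hy0 hy2 using hy
  have hyc : ∀ j, y j ^ 2 * c0 = -2 * f (ω j) := by
    intro j
    rw [hy2, hfc, Finset.sum_mul, Finset.mul_sum]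
    refine Finset.sum_congr rfl fun i _ => ?_
    field_simp
  obtain ⟨K, hK, hid⟩ := upper_identity (fun i : Fin r => a i.succ) ζ hζ (fun i => -2 * c i / c0)
  have hid := hid y hy0 hy2
  have hdsum : ∑ i, a i = ∑ i : Fin r, a i.succ + 1 := by
    rw [Fin.sum_univ_succ, ha0, add_comm]
  let sg : Bool → ℂ := fun b => if b then 1 else -1
  have hroot : ∀ q : J × Bool, ∃ ρ : ℂ, ρ ^ (∑ i, a i) =
      K⁻¹ * ((∏ i, ω q.1 i) * (y q.1)⁻¹) * sg q.2 := fun q =>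
    IsAlgClosed.exists_pow_nat_eq _ (by omega)
  choose ρ hρ using hroot
  let V : J × Bool → Fin (n + 1) → ℂ := fun q =>
    ρ q • (k + u q.1 + (sg q.2 * y q.1) • ℓ 0)
  have hcard : Fintype.card (J × Bool) = 2 * ∏ i : Fin r, (a i.succ + 1) := by
    simp [J, mul_comm]
  let E : Fin (2 * ∏ i : Fin r, (a i.succ + 1)) ≃ J × Bool := (Fintype.equivFinOfCardEq hcard).symm
  refine ⟨fun t => V (E t), ?_, ?_⟩
  · intro t
    obtain ⟨q, hq⟩ : ∃ q, q = E t := ⟨_, rfl⟩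
    have hsg : sg q.2 * sg q.2 = 1 := by
      cases q.2 <;> simp [sg]
    have : V q ⬝ᵥ V q = 0 := by
      have h1 := hyc q.1
      have h00 : ℓ 0 ⬝ᵥ ℓ 0 = c0 := by rw [hdot]; simp
      simp only [V, add_dotProduct, dotProduct_add, smul_dotProduct, dotProduct_smul, huu, huS,
        dotProduct_comm (u q.1) k, dotProduct_comm (ℓ 0) k, dotProduct_comm (ℓ 0) (u q.1),
        hkk, hku, hk0, smul_eq_mul, h00]
      linear_combination ρ q ^ 2 * h1 + ρ q ^ 2 * (y q.1 ^ 2 * c0) * hsg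
    change Isotropic (V (E t))
    rw [← hq]
    simpa [Isotropic, dotProduct, ← pow_two] using this
  · rw [E.sum_comp (fun q => lin (V q) ^ (∑ i, a i)), Fintype.sum_prod_type]
    apply MvPolynomial.funext
    intro x
    have h1 := hid (k ⬝ᵥ x) (ℓ 0 ⬝ᵥ x) (fun i => ℓ i.succ ⬝ᵥ x)
    have hux : ∀ j, u j ⬝ᵥ x = ∑ i : Fin r, (ℓ i.succ ⬝ᵥ x) * ζ i ^ (j i : ℕ) := by
      intro j
      simp [u, ω, sum_dotProduct, smul_dotProduct, mul_comm]
    simp only [map_prod, map_pow, map_sum, map_add, eval_lin, Fintype.sum_bool]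
    rw [Fin.prod_univ_succ, ha0, pow_one]
    rw [← hdsum, ← inv_mul_eq_iff_eq_mul₀ hK, Finset.mul_sum] at h1
    rw [← h1]
    refine Finset.sum_congr rfl fun j _ => ?_
    simp only [V, smul_dotProduct, add_dotProduct, smul_eq_mul, mul_pow, hρ, hux, ω, sg]
    simp only [if_true, Bool.false_eq_true, if_false]
    ring

lemma lap_lin_pow {n : ℕ} (v : Fin n → ℂ) (hv : Isotropic v) (d : ℕ) : lap (lin v ^ d) = 0 := by
  have hp : ∀ t, pderiv t (lin v) = C (v t) := by
    intro t
    simp [lin, pderiv_X, Pi.single_apply]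
  have h1 : ∀ t, pderiv t (pderiv t (lin v ^ d)) =
      C (v t ^ 2) * ((d : MvPolynomial (Fin n) ℂ) * (((d - 1 : ℕ) : MvPolynomial (Fin n) ℂ) *
        lin v ^ (d - 1 - 1))) := by
    intro t
    simp only [Derivation.leibniz_pow, Derivation.leibniz, hp, pderiv_C, smul_eq_mul, nsmul_eq_mul,
      map_pow, Derivation.map_natCast]
    ring
  simp only [lap, h1, ← Finset.sum_mul]
  rw [← map_sum]
  have : ∑ t, v t ^ 2 = 0 := hv
  rw [this, map_zero, zero_mul]

lemma lap_sum {n : ℕ} {ι : Type*} [Fintype ι] (p : ι → MvPolynomial (Fin n) ℂ) :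
    lap (∑ j, p j) = ∑ j, lap (p j) := by
  simp only [lap, map_sum]
  rw [Finset.sum_comm]

/-- Isotropic rank of a harmonic monomial with exactly one non-isotropic
linear form, appearing with exponent one: `irk m = 2·∏_{i=1}^r (aᵢ + 1)`. -/
theorem stmt14 (n r : ℕ) (hn : 1 ≤ n) (hr : 1 ≤ r)
    (ℓ : Fin (r + 1) → (Fin (n + 1) → ℂ)) (a : Fin (r + 1) → ℕ)
    (hli : LinearIndependent ℂ ℓ)
    (horth : ∀ i j : Fin (r + 1), i < j → ∑ t, ℓ i t * ℓ j t = 0)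
    (h0 : ¬ Isotropic (ℓ 0))
    (hiso : ∀ i : Fin (r + 1), i ≠ 0 → Isotropic (ℓ i))
    (ha0 : a 0 = 1) (hmono : Monotone a) :
    lap (∏ i, (lin (ℓ i)) ^ (a i)) = 0 ∧
    irk (∑ i, a i) (∏ i, (lin (ℓ i)) ^ (a i)) =
      2 * ∏ i : Fin r, (a i.succ + 1) := by

  obtain ⟨v, hv, h⟩ := upper_bound hr ℓ a hli horth h0 hiso ha0
  refine ⟨?_, le_antisymm (Nat.sInf_le ⟨v, hv, h⟩) ?_⟩
  · rw [h, lap_sum]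
    exact Finset.sum_eq_zero fun j _ => lap_lin_pow _ (hv j) _
  · refine le_csInf ⟨_, v, hv, h⟩ ?_
    rintro N ⟨w, hw, h'⟩
    exact lower_bound ℓ a hli horth h0 hiso ha0 w hw h'
end

section
/- For integers n, d define f(n,d) = C(n+d, n) − C(n+d−2, n). Let n ≥ 4, d ≥ 4 and let r, u, ε be natural numbers with r ≤ ⌈f(n,d)/n⌉, ε ≤ n − 2, and r·n = (n−1)·u + ε + f(n, d−1). Then: (1) (n−1)·ε + u ≤ f(n−1, d−1); (2) f(n, d−2) + (u+ε)·n ≤ r·n; (3) u + ε ≤ r; (4) if ⌊f(n,d)/n⌋ ≤ r, then ε ≤ u; (5) if d = 4 and n ≥ 9, then u + ε + n + 1 ≤ r. -/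
/-- `fQuad n d` is the dimension of the space of harmonic forms of degree `d`
in `n + 1` variables. -/
def fQuad (n d : ℕ) : ℕ := (n + d).choose n - (n + d - 2).choose n

theorem fQ_add (n d : ℕ) : fQuad n (d+2) + (n+d).choose n = (n+d+2).choose n := by
  unfold fQuad
  have : n + (d+2) - 2 = n + d := by omega
  rw [this, ← add_assoc]
  exact Nat.sub_add_cancel (Nat.choose_le_choose n (by omega))

theorem fQ_one (n : ℕ) (hn : 1 ≤ n) : fQuad n 1 = n + 1 := by
  unfold fQuad
  rw [Nat.choose_eq_zero_of_lt (show n + 1 - 2 < n by omega), Nat.choose_succ_self_right]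
  rfl

theorem fQ_zero (d : ℕ) : fQuad 0 (d+2) = 0 := by
  simp [fQuad]

theorem fQ_pascal (n d : ℕ) : fQuad (n+1) (d+2) = fQuad (n+1) (d+1) + fQuad n (d+2) := by
  have h1 := fQ_add (n+1) d
  have h2 := fQ_add n d
  have e1 : (n+1+d+2).choose (n+1) = (n+d+2).choose n + (n+d+2).choose (n+1) := by
    rw [show n+1+d+2 = (n+d+2)+1 by ring, Nat.choose_succ_succ']
  rcases d with _ | d
  · rw [fQ_one (n+1) (by omega)]
    have := Nat.choose_succ_self_right (n+1)
    simp only [add_zero, zero_add, Nat.choose_self] at *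
    rw [show n + 1 + 1 = n + 2 by ring] at *
    omega
  · have h3 := fQ_add (n+1) d
    have e2 : (n+1+(d+1)).choose (n+1) = (n+d+1).choose n + (n+d+1).choose (n+1) := by
      rw [show n+1+(d+1) = (n+d+1)+1 by ring, Nat.choose_succ_succ']
    rw [show n+1+d+2 = n+(d+1)+2 by ring, show n+1+d = n+d+1 by ring] at h3
    rw [show n+d+1 = n+(d+1) by ring] at *
    rw [show d+1+1 = d+2 by ring] at *
    omega

theorem fQ_two (n : ℕ) : 2 * fQuad n 2 = n * (n+3) := by
  induction n with
  | zero => simp [fQuad]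
  | succ k ih =>
    have := fQ_pascal k 0
    rw [fQ_one (k+1) (by omega)] at this
    simp only [zero_add] at this
    rw [this]; linarith

theorem fQ_three (n : ℕ) : 6 * fQuad n 3 = n * (n+1) * (n+5) := by
  induction n with
  | zero => simp [fQuad]
  | succ k ih =>
    have := fQ_pascal k 1
    have h := fQ_two (k+1)
    simp only [Nat.reduceAdd] at this
    rw [this]; linarith

theorem fQ_four (n : ℕ) : 24 * fQuad n 4 = n * (n+1) * (n+2) * (n+7) := by
  induction n with
  | zero => simp [fQuad]
  | succ k ih =>
    have := fQ_pascal k 2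
    have h := fQ_three (k+1)
    simp only [Nat.reduceAdd] at this
    rw [this]; linarith

theorem fQ_mono (k d : ℕ) : fQuad k (d+2) ≤ fQuad (k+1) (d+2) := by
  have := fQ_pascal k d
  omega

theorem fQ_ratio (k d : ℕ) : fQuad k (d+3) ≤ (k+1) * fQuad k (d+2) := by
  induction k with
  | zero => rw [fQ_zero (d+1)]; omega
  | succ k ih =>
    have h := fQ_pascal k (d+1)
    have h2 := fQ_mono k d
    rw [show d+1+2 = d+3 by ring, show d+1+1 = d+2 by ring] at h
    nlinarith

theorem fQ_key (m e : ℕ) (hm : 3 ≤ m) :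
    fQuad m (e+4) + m^3 + 2 ≤ m * fQuad m (e+3) + m^2 + m := by
  induction e with
  | zero =>
    have h3 := fQ_three m
    have h4 := fQ_four m
    simp only [zero_add]
    obtain ⟨t, rfl⟩ := Nat.exists_eq_add_of_le hm
    have h3' : 6 * ((3+t) * fQuad (3+t) 3) = (3+t) * ((3+t) * ((3+t)+1) * ((3+t)+5)) := by
      rw [← h3]; ring
    nlinarith [sq_nonneg t, Nat.zero_le (t^3), Nat.zero_le (t^4)]
  | succ e ih =>
    obtain ⟨k, rfl⟩ : ∃ k, m = k+1 := ⟨m-1, by omega⟩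
    have p1 := fQ_pascal k (e+3)
    have p2 := fQ_pascal k (e+2)
    have r := fQ_ratio k (e+2)
    simp only [add_assoc, Nat.reduceAdd] at *
    rw [p1]
    have : (k+1) * fQuad (k+1) (e+4) = (k+1) * fQuad (k+1) (e+3) + (k+1) * fQuad k (e+4) := by
      rw [p2]; ring
    linarith

theorem fQ_dmono (m e : ℕ) : fQuad (m+1) 4 ≤ fQuad (m+1) (e+4) := by
  induction e with
  | zero => simp
  | succ e ih =>
    have p1 := fQ_pascal m (e+3)
    simp only [add_assoc, Nat.reduceAdd] at *
    omega

theorem stmt17 (n d r u ε : ℕ) (hn : 4 ≤ n) (hd : 4 ≤ d)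
    (hr : r ≤ (fQuad n d + n - 1) / n) (hε : ε ≤ n - 2)
    (heq : r * n = (n - 1) * u + ε + fQuad n (d - 1)) :
    ((n - 1) * ε + u ≤ fQuad (n - 1) (d - 1)) ∧
    (fQuad n (d - 2) + (u + ε) * n ≤ r * n) ∧
    (u + ε ≤ r) ∧
    (fQuad n d / n ≤ r → ε ≤ u) ∧
    (d = 4 → 9 ≤ n → u + ε + n + 1 ≤ r) := by
  obtain ⟨m, rfl⟩ : ∃ m, n = m+1 := ⟨n-1, by omega⟩
  obtain ⟨e, rfl⟩ : ∃ e, d = e+4 := ⟨d-4, by omega⟩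
  have hm : 3 ≤ m := by omega
  have hr' : r * (m+1) ≤ fQuad (m+1) (e+4) + m := by
    have := (Nat.le_div_iff_mul_le (by omega)).1 hr
    omega
  have hε' : ε + 1 ≤ m := by omega
  have p1 := fQ_pascal m (e+2)
  have p2 := fQ_pascal m (e+1)
  simp only [show m + 1 - 1 = m by omega, show e + 4 - 1 = e + 3 by omega,
    show e + 4 - 2 = e + 2 by omega, add_assoc, Nat.reduceAdd] at *
  have hu : m * u + ε ≤ fQuad m (e+4) + m := by omega
  have key := fQ_key m e hm
  have c1 : m * ε + u ≤ fQuad m (e+3) := by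
    by_contra hc
    have hc : fQuad m (e+3) + 1 ≤ m * ε + u := by omega
    have h1 : m * fQuad m (e+3) + m ≤ m * (m * ε) + m * u := by
      have := Nat.mul_le_mul_left m hc
      linarith
    have h2 : m^2 * ε + m^2 + m ≤ m^3 + ε + 1 := by
      obtain ⟨s, hs⟩ := Nat.exists_eq_add_of_le hε'
      have h3 : s ≤ m^2 * s := Nat.le_mul_of_pos_left s (by positivity)
      have h4 : m^3 = m^2 * ε + m^2 + m^2 * s := by
        calc m^3 = m^2 * m := by ring
          _ = m^2 * (ε + 1 + s) := by rw [← hs]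
          _ = _ := by ring
      omega
    have h5 : m * (m * ε) = m^2 * ε := by ring
    omega
  have c2 : fQuad (m+1) (e+2) + (u + ε) * (m+1) ≤ r * (m+1) := by
    rw [heq, p2]; linarith
  refine ⟨c1, c2, ?_, ?_, ?_⟩
  · exact Nat.le_of_mul_le_mul_right (by omega : (u+ε) * (m+1) ≤ r * (m+1)) (by omega)
  · intro h
    have h' : fQuad (m+1) (e+4) ≤ r * (m+1) + m := by
      have := Nat.lt_mul_of_div_lt (Nat.lt_succ_of_le h) (Nat.succ_pos m)
      have e1 : (m+1) * (r+1) = r*(m+1) + m + 1 := by ring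
      simp only [Nat.succ_eq_add_one] at this
      first | omega | linarith
    obtain ⟨k, rfl⟩ : ∃ k, m = k+1 := ⟨m-1, by omega⟩
    have hb := fQ_dmono k e
    have h4 := fQ_four (k+1)
    by_contra hc
    have hc : u + 1 ≤ ε := by omega
    have hu2 : u + 1 ≤ k := by omega
    have hl : fQuad (k+1) (e+4) ≤ (k+1) * u + ε + (k+1) := by omega
    have h5 : (k+1) * (u+1) ≤ (k+1) * k := Nat.mul_le_mul_left _ hu2
    obtain ⟨t, rfl⟩ := Nat.exists_eq_add_of_le (show 2 ≤ k by omega)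
    nlinarith [Nat.zero_le (t^2), Nat.zero_le (t^3), Nat.zero_le (t^4)]
  · intro h9 hn9
    obtain rfl : e = 0 := by omega
    have h3 := fQ_three (m+1)
    have h4 := fQ_four m
    simp only [zero_add] at *
    obtain ⟨t, rfl⟩ := Nat.exists_eq_add_of_le (show 8 ≤ m by omega)
    have hu3 : 24 * u ≤ (8+t+1) * (8+t+2) * (8+t+7) + 24 := by
      refine Nat.le_of_mul_le_mul_left (c := 8+t) ?_ (show 0 < 8+t by omega)
      linarith
    have hεm : (8+t) * ε ≤ (8+t) * (7+t) := Nat.mul_le_mul_left _ (by omega)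
    refine Nat.le_of_mul_le_mul_right (c := 8+t+1) ?_ (show 0 < 8+t+1 by omega)
    rw [heq]
    nlinarith [Nat.zero_le (t^2), Nat.zero_le (t^3)]
end
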